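/- arXiv:1912.05739 — 3 statements merged into one kernel-verified Lean document; each statement's English description precedes it below -/
import Mathlib

section
/- A zero-mean nonsingular Gaussian sequence [x_k], k ∈ [0,N], with covariance matrix C is CM_c for c ∈ {0,N} if and only if C⁻¹ has the CM_c form (the CM_F form for c = 0 and the CM_L form for c = N). -/
open MeasureTheory ProbabilityTheory Matrix
open scoped NNReal

namespace CMSeqPaper

variable {Ω : Type*} [MeasurableSpace Ω]

/-- Square `d × d` real matrices. -/
abbrev Mat (d : ℕ) := Matrix (Fin d) (Fin d) ℝ

/-- `X` is a zero-mean jointly Gaussian random vector with covariance matrix `C`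
(Cramér–Wold characterization: every linear functional of `X` is a centered real
Gaussian with the induced variance). -/
def IsZeroMeanGaussian {ι : Type*} [Fintype ι] (μ : Measure Ω)
    (X : Ω → ι → ℝ) (C : Matrix ι ι ℝ) : Prop :=
  ∀ l : ι → ℝ,
    μ.map (fun ω => ∑ i, l i * X ω i) = gaussianReal 0 (l ⬝ᵥ C.mulVec l).toNNReal

/-- The stacked vector over times `0, …, N` of a `d`-dimensional sequence. -/
def stack (N d : ℕ) (x : ℕ → Ω → Fin d → ℝ) : Ω → Fin (N + 1) × Fin d → ℝ :=
  fun ω p => x (p.1 : ℕ) ω p.2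

/-- `[x_k]`, `k ∈ [0,N]`, is a zero-mean nonsingular Gaussian sequence whose stacked
vector has (positive definite) covariance matrix `C`. -/
def ZMNG (N d : ℕ) (μ : Measure Ω) (x : ℕ → Ω → Fin d → ℝ)
    (C : Matrix (Fin (N + 1) × Fin d) (Fin (N + 1) × Fin d) ℝ) : Prop :=
  (∀ k, k ≤ N → Measurable (x k)) ∧
    IsZeroMeanGaussian μ (stack N d x) C ∧ C.PosDef

/-- The σ-algebra generated by the states at the times in `S`. -/
def sigmaOf {d : ℕ} (x : ℕ → Ω → Fin d → ℝ) (S : Set ℕ) : MeasurableSpace Ω :=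
  ⨆ i ∈ S, MeasurableSpace.comap (x i) inferInstance

/-- The conditional distribution of `x k` given the states at the times in `S`
coincides (a.e.) with the conditional distribution of `x k` given the states at the
times in `T`. -/
def CondEq {d : ℕ} (μ : Measure Ω) (x : ℕ → Ω → Fin d → ℝ) (k : ℕ)
    (S T : Set ℕ) : Prop :=
  ∀ A : Set (Fin d → ℝ), MeasurableSet A →
    μ[A.indicator (fun _ => (1 : ℝ)) ∘ x k | sigmaOf x S]
      =ᵐ[μ] μ[A.indicator (fun _ => (1 : ℝ)) ∘ x k | sigmaOf x T]

/-- `[x_k]` is `[k₁,k₂]`-CM_c: for all `k₁ ≤ j < k ≤ k₂`, the conditional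
distribution of `x k` given `(x_{k₁}, …, x_j, x_c)` equals the one given `(x_j, x_c)`. -/
def IsCM {d : ℕ} (μ : Measure Ω) (x : ℕ → Ω → Fin d → ℝ) (k₁ k₂ c : ℕ) : Prop :=
  ∀ j k, k₁ ≤ j → j < k → k ≤ k₂ →
    CondEq μ x k (Set.Icc k₁ j ∪ {c}) ({j} ∪ {c})

/-- `[x_k]` is Markov on the index interval `[a,b]`. -/
def IsMarkovOn {d : ℕ} (μ : Measure Ω) (x : ℕ → Ω → Fin d → ℝ) (a b : ℕ) : Prop :=
  ∀ j k, a ≤ j → j < k → k ≤ b → CondEq μ x k (Set.Icc a j) {j}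

/-- `[x_k]` is reciprocal on `[0,N]`. -/
def IsReciprocal {d : ℕ} (μ : Measure Ω) (x : ℕ → Ω → Fin d → ℝ) (N : ℕ) : Prop :=
  ∀ j k l, j < k → k < l → l ≤ N →
    CondEq μ x k (Set.Icc 0 j ∪ Set.Icc l N) ({j} ∪ {l})

/-- Block `(i,j)` of the block matrix `A` is zero. -/
def BlockZero {n d : ℕ} (A : Matrix (Fin n × Fin d) (Fin n × Fin d) ℝ)
    (i j : Fin n) : Prop :=
  ∀ a b, A (i, a) (j, b) = 0

/-- `|i - j| ≥ 2` for block indices. -/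
def Far {n : ℕ} (i j : Fin n) : Prop :=
  (i : ℕ) + 2 ≤ (j : ℕ) ∨ (j : ℕ) + 2 ≤ (i : ℕ)

/-- Block tri-diagonal: every block `(i,j)` with `|i-j| ≥ 2` is zero. -/
def BlockTriDiag {n d : ℕ} (A : Matrix (Fin n × Fin d) (Fin n × Fin d) ℝ) : Prop :=
  ∀ i j, Far i j → BlockZero A i j

/-- The CM_L form: every block `(i,j)` with `|i-j| ≥ 2` is zero except possibly
blocks in the last block row and last block column. -/
def HasCMLForm {n d : ℕ} (A : Matrix (Fin n × Fin d) (Fin n × Fin d) ℝ) : Prop :=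
  ∀ i j, Far i j → (i : ℕ) ≠ n - 1 → (j : ℕ) ≠ n - 1 → BlockZero A i j

/-- The CM_F form: every block `(i,j)` with `|i-j| ≥ 2` is zero except possibly
blocks in the first block row and first block column. -/
def HasCMFForm {n d : ℕ} (A : Matrix (Fin n × Fin d) (Fin n × Fin d) ℝ) : Prop :=
  ∀ i j, Far i j → (i : ℕ) ≠ 0 → (j : ℕ) ≠ 0 → BlockZero A i j

/-- Cyclic block tri-diagonal: every block `(i,j)` with `|i-j| ≥ 2` is zero except
possibly the corner blocks `(0, n-1)` and `(n-1, 0)`. -/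
def CyclicBlockTriDiag {n d : ℕ} (A : Matrix (Fin n × Fin d) (Fin n × Fin d) ℝ) : Prop :=
  ∀ i j, Far i j → ¬((i : ℕ) = 0 ∧ (j : ℕ) = n - 1) →
    ¬((i : ℕ) = n - 1 ∧ (j : ℕ) = 0) → BlockZero A i j

/-- The stacked block-diagonal matrix with diagonal blocks `G 0, …, G N`. -/
def blockDiag (N d : ℕ) (G : ℕ → Mat d) :
    Matrix (Fin (N + 1) × Fin d) (Fin (N + 1) × Fin d) ℝ :=
  fun p q => if (p.1 : ℕ) = (q.1 : ℕ) then G (p.1 : ℕ) p.2 q.2 else 0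

/-- `[x_k]` obeys the CM_L model with parameters `Gm k = G_{k,k-1}` and
`GN k = G_{k,N}` for `k ∈ [1,N-1]`, boundary parameter `GN 0 = G_{0,N}`, and noise
covariances `Gcov k = G_k = Cov(e_k)`: the `e_k` are zero-mean jointly Gaussian,
mutually uncorrelated, with positive definite covariances, with
`x_k = G_{k,k-1} x_{k-1} + G_{k,N} x_N + e_k` for `k ∈ [1,N-1]`, and boundary
condition `x_N = e_N`, `x_0 = G_{0,N} x_N + e_0`. -/
def CMLModel (N d : ℕ) (μ : Measure Ω) (x : ℕ → Ω → Fin d → ℝ)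
    (Gm GN Gcov : ℕ → Mat d) : Prop :=
  ∃ e : ℕ → Ω → Fin d → ℝ,
    ZMNG N d μ e (blockDiag N d Gcov) ∧
    (∀ k, k ≤ N → (Gcov k).PosDef) ∧
    (∀ᵐ ω ∂μ,
      (∀ k, 1 ≤ k → k ≤ N - 1 →
        x k ω = (Gm k).mulVec (x (k - 1) ω) + (GN k).mulVec (x N ω) + e k ω) ∧
      x N ω = e N ω ∧ x 0 ω = (GN 0).mulVec (x N ω) + e 0 ω)

/-- `[y_k]` obeys the Markov model with parameters `Mm k = M_{k,k-1}` for
`k ∈ [1,N]` and noise covariances `Mcov k = M_k = Cov(e_k)`: the `e_k` are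
zero-mean jointly Gaussian, mutually uncorrelated, with positive definite
covariances, `y_0 = e_0` and `y_k = M_{k,k-1} y_{k-1} + e_k` for `k ∈ [1,N]`. -/
def MarkovModel (N d : ℕ) (μ : Measure Ω) (y : ℕ → Ω → Fin d → ℝ)
    (Mm Mcov : ℕ → Mat d) : Prop :=
  ∃ e : ℕ → Ω → Fin d → ℝ,
    ZMNG N d μ e (blockDiag N d Mcov) ∧
    (∀ k, k ≤ N → (Mcov k).PosDef) ∧
    (∀ᵐ ω ∂μ, y 0 ω = e 0 ω ∧
      ∀ k, 1 ≤ k → k ≤ N → y k ω = (Mm k).mulVec (y (k - 1) ω) + e k ω)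

/-- Representation of `[x_k]` as a zero-mean nonsingular Gaussian Markov sequence
plus `Γ_k x_c`, where `c ∈ {0,N}`: `y` (which coincides with `x` at time `c`) is
jointly zero-mean nonsingular Gaussian, the states of `y` at times `≠ c` are
uncorrelated with `y c = x c`, `y` is Markov on `[0,N] \ {c}`, and
`x_k = y_k + Γ_k x_c` for `k ∈ [0,N] \ {c}`. -/
def MarkovPlusVector (N d c : ℕ) (μ : Measure Ω) (x y : ℕ → Ω → Fin d → ℝ)
    (Γ : ℕ → Mat d) : Prop :=
  ∃ C' : Matrix (Fin (N + 1) × Fin d) (Fin (N + 1) × Fin d) ℝ,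
    (∀ᵐ ω ∂μ, y c ω = x c ω) ∧
    ZMNG N d μ y C' ∧
    (∀ i j : Fin (N + 1),
      (((i : ℕ) = c ∧ (j : ℕ) ≠ c) ∨ ((i : ℕ) ≠ c ∧ (j : ℕ) = c)) →
      ∀ a b, C' (i, a) (j, b) = 0) ∧
    IsMarkovOn μ y (if c = 0 then 1 else 0) (if c = 0 then N else N - 1) ∧
    (∀ᵐ ω ∂μ, ∀ k, k ≤ N → k ≠ c → x k ω = y k ω + (Γ k).mulVec (x c ω))

/-- `M_{N|k} = M_{N,N-1} ⋯ M_{k+1,k}` (with `M_{N|N} = I`), where `Mm k = M_{k,k-1}`. -/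
def MNk (d : ℕ) (Mm : ℕ → Mat d) (N k : ℕ) : Mat d :=
  (List.range (N - k)).foldl (fun A i => A * Mm (N - i)) 1

/-- `C_{N|k} = ∑_{n=k}^{N-1} M_{N|n+1} M_{n+1} M_{N|n+1}'`. -/
def CNk (d : ℕ) (Mm Mcov : ℕ → Mat d) (N k : ℕ) : Mat d :=
  ∑ n ∈ Finset.Icc k (N - 1), MNk d Mm N (n + 1) * Mcov (n + 1) * (MNk d Mm N (n + 1))ᵀ

/-- The `(N+1)d × (N+1)d` matrix `[[B₁, 0], [0, 0]]` (`B₁` occupies the first `N`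
block rows and columns). -/
def embedL (N d : ℕ) (B₁ : Matrix (Fin N × Fin d) (Fin N × Fin d) ℝ) :
    Matrix (Fin (N + 1) × Fin d) (Fin (N + 1) × Fin d) ℝ :=
  fun p q =>
    if h : (p.1 : ℕ) < N ∧ (q.1 : ℕ) < N then
      B₁ (⟨(p.1 : ℕ), h.1⟩, p.2) (⟨(q.1 : ℕ), h.2⟩, q.2)
    else 0

/-- The `(N+1)d × d` matrix `Γ = [S; I]`. -/
def gammaL (N d : ℕ) (S : Matrix (Fin N × Fin d) (Fin d) ℝ) :
    Matrix (Fin (N + 1) × Fin d) (Fin d) ℝ :=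
  fun p a =>
    if h : (p.1 : ℕ) < N then S (⟨(p.1 : ℕ), h⟩, p.2) a
    else (1 : Mat d) p.2 a

/-- The `(N+1)d × (N+1)d` matrix `[[0, 0], [0, B₂]]` (`B₂` occupies the last `N`
block rows and columns). -/
def embedF (N d : ℕ) (B₂ : Matrix (Fin N × Fin d) (Fin N × Fin d) ℝ) :
    Matrix (Fin (N + 1) × Fin d) (Fin (N + 1) × Fin d) ℝ :=
  fun p q =>
    if h : 0 < (p.1 : ℕ) ∧ 0 < (q.1 : ℕ) then
      B₂ (⟨(p.1 : ℕ) - 1, by have := p.1.isLt; omega⟩, p.2)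
        (⟨(q.1 : ℕ) - 1, by have := q.1.isLt; omega⟩, q.2)
    else 0

/-- The `(N+1)d × d` matrix `Γ = [I; S]`. -/
def gammaF (N d : ℕ) (S : Matrix (Fin N × Fin d) (Fin d) ℝ) :
    Matrix (Fin (N + 1) × Fin d) (Fin d) ℝ :=
  fun p a =>
    if h : 0 < (p.1 : ℕ) then
      S (⟨(p.1 : ℕ) - 1, by have := p.1.isLt; omega⟩, p.2) a
    else (1 : Mat d) p.2 a
lemma exists_solve {ι : Type*} [Fintype ι] [DecidableEq ι] {M : Matrix ι ι ℝ} (hM : M.PosDef)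
    (P : ι → Prop) (f : ι → ℝ) :
    ∃ u : ι → ℝ, (∀ p, ¬ P p → u p = 0) ∧ ∀ p, P p → (M *ᵥ u) p = f p := by
  classical
  have hs : (M.submatrix (Subtype.val : {p // P p} → ι) Subtype.val).PosDef :=
    hM.submatrix Subtype.val_injective
  set A := M.submatrix (Subtype.val : {p // P p} → ι) Subtype.val with hA
  set u0 := A⁻¹ *ᵥ (fun p => f p.1) with hu0
  have h0 : A *ᵥ u0 = fun p => f p.1 := by
    rw [hu0, Matrix.mulVec_mulVec, Matrix.mul_nonsing_inv _ ((Matrix.isUnit_iff_isUnit_det _).1 hs.isUnit),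
      Matrix.one_mulVec]
  refine ⟨fun p => if h : P p then u0 ⟨p, h⟩ else 0, fun p hp => by simp [hp], fun p hp => ?_⟩
  have h1 := congrFun h0 ⟨p, hp⟩
  simp only at h1
  rw [← h1]
  simp only [Matrix.mulVec, dotProduct, hA, Matrix.submatrix_apply]
  have h2 := Finset.sum_subtype (p := P) (F := inferInstance) (Finset.univ.filter P) (by simp)
    (fun i => M p i * (if h : P i then u0 ⟨i, h⟩ else 0))
  rw [Finset.sum_filter_of_ne] at h2
  · refine h2.trans (Finset.sum_congr rfl fun i _ => ?_)
    rw [dif_pos i.2]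
  · intro i _ hi
    by_contra hP
    exact hi (by rw [dif_neg hP, mul_zero])

lemma lin1 {ι : Type*} [Fintype ι] [DecidableEq ι] {C : Matrix ι ι ℝ} (hC : C.PosDef)
    (P T : ι → Prop) (hPT : ∀ p, P p → ¬ T p)
    (hB : ∀ v : ι → ℝ, (∀ p, ¬ (P p ∨ T p) → v p = 0) → (∀ t, T t → (C *ᵥ v) t = 0) →
      ∀ k, ¬ (P k ∨ T k) → (C *ᵥ v) k = 0) (i : ι) (hi : P i) (k : ι) (hk : ¬ (P k ∨ T k)) :
    C⁻¹ k i = 0 := by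
  obtain ⟨v, hv0, hv⟩ := exists_solve hC (fun p => P p ∨ T p) (Pi.single i 1)
  have hne : ∀ t, ¬ P t → (Pi.single i (1 : ℝ) : ι → ℝ) t = 0 := fun t ht => by
    rw [Pi.single_apply, if_neg]; rintro rfl; exact ht hi
  have h1 := hB v hv0 (fun t ht => by
    rw [hv t (Or.inr ht)]; exact hne t fun h => hPT t h ht)
  have h2 : C *ᵥ v = Pi.single i 1 := by
    ext p
    by_cases hp : P p ∨ T p
    · exact hv p hp
    · rw [h1 p hp, hne p fun h => hp (Or.inl h)]
  have h3 : v = C⁻¹ *ᵥ Pi.single i 1 := by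
    rw [← h2, Matrix.mulVec_mulVec, Matrix.nonsing_inv_mul _ ((Matrix.isUnit_iff_isUnit_det _).1 hC.isUnit),
      Matrix.one_mulVec]
  have h4 := hv0 k hk
  rw [h3] at h4
  simpa using h4

lemma lin2 {ι : Type*} [Fintype ι] [DecidableEq ι] {C : Matrix ι ι ℝ} (hC : C.PosDef)
    (P T : ι → Prop) (hPT : ∀ p, P p → ¬ T p)
    (h : ∀ i, P i → ∀ k, ¬ (P k ∨ T k) → C⁻¹ k i = 0) (k : ι) (hk : ¬ P k) :
    ∃ l : ι → ℝ, (∀ p, ¬ T p → l p = 0) ∧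
      ∀ q, P q ∨ T q → (C *ᵥ (Pi.single k 1 - l)) q = 0 := by
  obtain ⟨l, hl0, hl⟩ := exists_solve hC T (C *ᵥ Pi.single k 1)
  have hT : ∀ t, T t → (C *ᵥ (Pi.single k 1 - l)) t = 0 := fun t ht => by
    rw [Matrix.mulVec_sub, Pi.sub_apply, hl t ht, sub_self]
  refine ⟨l, hl0, fun q hq => ?_⟩
  by_cases hqT : T q
  · exact hT q hqT
  have hqP : P q := hq.resolve_right hqT
  obtain ⟨u, hu0, hu⟩ := exists_solve hC.inv P (Pi.single q 1)
  set w : ι → ℝ := Pi.single k 1 - l with hw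
  have hwP : ∀ p, P p → w p = 0 := fun p hp => by
    rw [hw, Pi.sub_apply, hl0 p (hPT p hp), Pi.single_apply, if_neg, sub_zero]
    rintro rfl; exact hk hp
  have hv : ∀ p, ¬ T p → (C⁻¹ *ᵥ u) p = (Pi.single q (1 : ℝ) : ι → ℝ) p := fun p hp => by
    by_cases hpP : P p
    · exact hu p hpP
    · rw [Pi.single_apply, if_neg (by rintro rfl; exact hpP hqP)]
      simp only [Matrix.mulVec, dotProduct]
      refine Finset.sum_eq_zero fun i _ => ?_
      by_cases hi : P i
      · rw [h i hi p (by tauto), zero_mul]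
      · rw [hu0 i hi, mul_zero]
  have hsym : Cᵀ = C := by simpa using hC.isHermitian.eq
  have e1 : (C *ᵥ w) ⬝ᵥ (C⁻¹ *ᵥ u) = 0 := by
    rw [dotProduct_comm, Matrix.dotProduct_mulVec, ← Matrix.mulVec_transpose, hsym,
      Matrix.mulVec_mulVec, Matrix.mul_nonsing_inv _ ((Matrix.isUnit_iff_isUnit_det _).1 hC.isUnit),
      Matrix.one_mulVec]
    refine Finset.sum_eq_zero fun p _ => ?_
    by_cases hp : P p
    · rw [hwP p hp, mul_zero]
    · rw [hu0 p hp, zero_mul]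
  have e2 : (C *ᵥ w) ⬝ᵥ (C⁻¹ *ᵥ u - Pi.single q 1) = 0 := by
    refine Finset.sum_eq_zero fun p _ => ?_
    by_cases hp : T p
    · rw [hT p hp, zero_mul]
    · rw [Pi.sub_apply, hv p hp, sub_self, mul_zero]
  rw [dotProduct_sub, e1, zero_sub, neg_eq_zero] at e2
  simpa using e2

/-- linear functional of a random vector -/
def ell {ι : Type*} [Fintype ι] (X : Ω → ι → ℝ) (l : ι → ℝ) : Ω → ℝ :=
  fun ω => ∑ i, l i * X ω i

lemma ell_add {ι : Type*} [Fintype ι] (X : Ω → ι → ℝ) (l m : ι → ℝ) :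
    ell X (l + m) = ell X l + ell X m := by
  funext ω
  simp [ell, add_mul, Finset.sum_add_distrib]

lemma ell_sub {ι : Type*} [Fintype ι] (X : Ω → ι → ℝ) (l m : ι → ℝ) :
    ell X (l - m) = ell X l - ell X m := by
  funext ω
  simp [ell, sub_mul, Finset.sum_sub_distrib]

lemma ell_single {ι : Type*} [Fintype ι] [DecidableEq ι] (X : Ω → ι → ℝ) (i : ι) (ω : Ω) :
    ell X (Pi.single i 1) ω = X ω i := by
  simp [ell, Pi.single_apply]

lemma measurable_ell {ι : Type*} [Fintype ι] {X : Ω → ι → ℝ} (hX : Measurable X) (l : ι → ℝ) :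
    Measurable (ell X l) := by
  unfold ell
  fun_prop

lemma gauss_law {ι : Type*} [Fintype ι] {μ : Measure Ω} {X : Ω → ι → ℝ}
    {C : Matrix ι ι ℝ} (hX : Measurable X) (h : IsZeroMeanGaussian μ X C) :
    HasGaussianLaw X μ := by
  classical
  constructor
  refine isGaussian_of_map_eq_gaussianReal fun L =>
    ⟨0, ((fun i => L (Pi.single i 1)) ⬝ᵥ C.mulVec (fun i => L (Pi.single i 1))).toNNReal, ?_⟩
  rw [← h, Measure.map_map L.continuous.measurable hX]
  congr 1
  funext ω
  simp only [Function.comp_apply]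
  conv_lhs => rw [pi_eq_sum_univ' (X ω)]
  rw [map_sum]
  refine Finset.sum_congr rfl fun i _ => ?_
  rw [map_smul, smul_eq_mul, mul_comm]

lemma ell_memLp {ι : Type*} [Fintype ι] {μ : Measure Ω} {X : Ω → ι → ℝ}
    {C : Matrix ι ι ℝ} (hX : Measurable X) (h : IsZeroMeanGaussian μ X C) (l : ι → ℝ) :
    MemLp (ell X l) 2 μ := by
  have h1 := memLp_id_gaussianReal' (μ := 0) (v := (l ⬝ᵥ C.mulVec l).toNNReal) 2 (by simp)
  rw [← h l] at h1
  exact h1.comp_of_map (measurable_ell hX l).aemeasurable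

lemma ell_mean {ι : Type*} [Fintype ι] {μ : Measure Ω} {X : Ω → ι → ℝ}
    {C : Matrix ι ι ℝ} (hX : Measurable X) (h : IsZeroMeanGaussian μ X C) (l : ι → ℝ) :
    ∫ ω, ell X l ω ∂μ = 0 := by
  have h1 := integral_id_gaussianReal (μ := 0) (v := (l ⬝ᵥ C.mulVec l).toNNReal)
  rw [← h l] at h1
  change ∫ x, x ∂(μ.map (ell X l)) = 0 at h1
  rw [integral_map (measurable_ell hX l).aemeasurable (by fun_prop)] at h1
  exact h1

lemma ell_var {ι : Type*} [Fintype ι] {μ : Measure Ω} {X : Ω → ι → ℝ}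
    {C : Matrix ι ι ℝ} (hC : C.PosDef) (hX : Measurable X) (h : IsZeroMeanGaussian μ X C)
    (l : ι → ℝ) :
    Var[ell X l; μ] = l ⬝ᵥ C.mulVec l := by
  have h1 := variance_id_gaussianReal (μ := 0) (v := (l ⬝ᵥ C.mulVec l).toNNReal)
  rw [← h l] at h1
  change Var[id; μ.map (ell X l)] = _ at h1
  rw [variance_map (by fun_prop) (measurable_ell hX l).aemeasurable] at h1
  have h2 : 0 ≤ l ⬝ᵥ C.mulVec l := by simpa using hC.posSemidef.dotProduct_mulVec_nonneg l
  rw [Real.coe_toNNReal _ h2] at h1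
  exact h1

lemma ell_cov {ι : Type*} [Fintype ι] {μ : Measure Ω} [IsProbabilityMeasure μ] {X : Ω → ι → ℝ}
    {C : Matrix ι ι ℝ} (hC : C.PosDef) (hX : Measurable X) (h : IsZeroMeanGaussian μ X C)
    (l m : ι → ℝ) :
    cov[ell X l, ell X m; μ] = l ⬝ᵥ C.mulVec m := by
  have h1 := variance_add (ell_memLp hX h l) (ell_memLp hX h m)
  rw [← ell_add, ell_var hC hX h, ell_var hC hX h, ell_var hC hX h] at h1
  have hsym : Cᵀ = C := by simpa using hC.isHermitian.eq
  have h2 : m ⬝ᵥ C.mulVec l = l ⬝ᵥ C.mulVec m := by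
    rw [dotProduct_comm, dotProduct_mulVec, ← mulVec_transpose, hsym]
  rw [mulVec_add, add_dotProduct, dotProduct_add, dotProduct_add, h2] at h1
  linarith

lemma ell_indep {ι κ κ' : Type*} [Fintype ι] [Fintype κ] [Fintype κ'] {μ : Measure Ω}
    [IsProbabilityMeasure μ] {X : Ω → ι → ℝ}
    {C : Matrix ι ι ℝ} (hC : C.PosDef) (hX : Measurable X) (h : IsZeroMeanGaussian μ X C)
    (R : κ → ι → ℝ) (Q : κ' → ι → ℝ) (hRQ : ∀ a b, R a ⬝ᵥ C.mulVec (Q b) = 0) :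
    IndepFun (fun ω a => ell X (R a) ω) (fun ω b => ell X (Q b) ω) μ := by
  refine HasGaussianLaw.indepFun_of_covariance_eval (X := fun a => ell X (R a))
    (Y := fun b => ell X (Q b)) ?_ ?_
  · exact (gauss_law hX h).map_fun (LinearMap.toContinuousLinearMap
      ((Matrix.mulVecLin (Matrix.of R)).prod (Matrix.mulVecLin (Matrix.of Q))))
  · intro a b
    rw [ell_cov hC hX h, hRQ]

/-- coordinates at times outside `S` replaced by zero -/
noncomputable def mask {n d : ℕ} (X : Ω → Fin n × Fin d → ℝ) (S : Set ℕ) :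
    Ω → Fin n × Fin d → ℝ :=
  open Classical in fun ω p => if (p.1 : ℕ) ∈ S then X ω p else 0

lemma measurable_stack {N d : ℕ} {x : ℕ → Ω → Fin d → ℝ} (hx : ∀ k, k ≤ N → Measurable (x k)) :
    Measurable (stack N d x) := by
  refine measurable_pi_lambda _ fun p => ?_
  exact (measurable_pi_apply p.2).comp (hx _ (Nat.lt_succ_iff.1 p.1.2))

lemma measurable_mask {n d : ℕ} {X : Ω → Fin n × Fin d → ℝ} (hX : Measurable X) (S : Set ℕ) :
    Measurable (mask X S) := by
  refine measurable_pi_lambda _ fun p => ?_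
  unfold mask
  by_cases hp : (p.1 : ℕ) ∈ S
  · simp only [hp, if_true]; fun_prop
  · simp only [hp, if_false]; fun_prop

lemma sigmaOf_eq {N d : ℕ} (x : ℕ → Ω → Fin d → ℝ) (S : Set ℕ) (hS : ∀ i ∈ S, i ≤ N) :
    sigmaOf x S = MeasurableSpace.comap (mask (stack N d x) S) inferInstance := by
  apply le_antisymm
  · refine iSup₂_le fun i hi => ?_
    have : x i = (fun (y : Fin (N + 1) × Fin d → ℝ) (a : Fin d) =>
        y (⟨i, Nat.lt_succ_of_le (hS i hi)⟩, a)) ∘ mask (stack N d x) S := by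
      funext ω a
      simp [mask, hi, stack]
    rw [this, ← MeasurableSpace.comap_comp]
    exact MeasurableSpace.comap_mono (Measurable.comap_le (by fun_prop))
  · rw [← measurable_iff_comap_le]
    refine @measurable_pi_lambda _ _ _ (sigmaOf x S) _ _ fun p => ?_
    by_cases hp : (p.1 : ℕ) ∈ S
    · simp only [mask, hp, if_true]
      have h1 : Measurable[sigmaOf x S] (x p.1) :=
        measurable_iff_comap_le.2 (le_iSup₂ (f := fun i (_ : i ∈ S) =>
          MeasurableSpace.comap (x i) inferInstance) (p.1 : ℕ) hp)
      exact (measurable_pi_apply p.2).comp h1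
    · simp only [mask, hp, if_false]
      exact measurable_const

lemma mask_eq_ell {n d : ℕ} (X : Ω → Fin n × Fin d → ℝ) (S : Set ℕ) :
    mask X S = open Classical in fun ω p => ell X (if (p.1 : ℕ) ∈ S then Pi.single p 1 else 0) ω := by
  funext ω p
  by_cases hp : (p.1 : ℕ) ∈ S
  · simp [mask, hp, ell_single]
  · simp [mask, hp, ell]

lemma ell_mask {n d : ℕ} (X : Ω → Fin n × Fin d → ℝ) (S : Set ℕ) (l : Fin n × Fin d → ℝ)
    (hl : ∀ p, (p.1 : ℕ) ∉ S → l p = 0) (ω : Ω) :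
    ∑ p, l p * mask X S ω p = ell X l ω := by
  refine Finset.sum_congr rfl fun p _ => ?_
  by_cases hp : (p.1 : ℕ) ∈ S
  · simp [mask, hp]
  · simp [hl p hp]

/-- conditional expectation of a function of two independent variables -/
lemma condExp_indep {β γ : Type*} [MeasurableSpace β] [MeasurableSpace γ] [StandardBorelSpace γ]
    [Nonempty γ] {μ : Measure Ω} [IsProbabilityMeasure μ] {Y : Ω → β} {r : Ω → γ}
    (hY : Measurable Y) (hr : Measurable r) (hind : IndepFun Y r μ) (f : β × γ → ℝ)
    (hf : StronglyMeasurable f) (hfi : Integrable (fun a => f (Y a, r a)) μ) :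
    μ[fun a => f (Y a, r a) | MeasurableSpace.comap Y inferInstance] =ᵐ[μ]
      fun a => ∫ y, f (Y a, y) ∂(μ.map r) := by
  have : IsProbabilityMeasure (μ.map r) := Measure.isProbabilityMeasure_map hr.aemeasurable
  have h1 : condDistrib r Y μ =ᵐ[μ.map Y] Kernel.const _ (μ.map r) := by
    apply condDistrib_ae_eq_of_measure_eq_compProd _ hr.aemeasurable
    rw [Measure.compProd_const]
    exact (indepFun_iff_map_prod_eq_prod_map_map hY.aemeasurable hr.aemeasurable).1 hind
  have h2 := ae_of_ae_map hY.aemeasurable h1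
  filter_upwards [condExp_prod_ae_eq_integral_condDistrib hY hr.aemeasurable hf hfi, h2] with a ha hb
  rw [ha, hb, Kernel.const_apply]

lemma condEq_of {N d : ℕ} {μ : Measure Ω} [IsProbabilityMeasure μ] {x : ℕ → Ω → Fin d → ℝ}
    {C : Matrix (Fin (N + 1) × Fin d) (Fin (N + 1) × Fin d) ℝ}
    (hx : ZMNG N d μ x C) (S T : Set ℕ) (hS : ∀ i ∈ S, i ≤ N) (hTS : T ⊆ S)
    (k : Fin (N + 1))
    (h : ∀ a : Fin d, ∃ l : Fin (N + 1) × Fin d → ℝ, (∀ p, (p.1 : ℕ) ∉ T → l p = 0) ∧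
      ∀ q, (q.1 : ℕ) ∈ S → (C *ᵥ (Pi.single (k, a) 1 - l)) q = 0) :
    CondEq μ x k S T := by
  classical
  obtain ⟨hxm, hg, hC⟩ := hx
  choose l hl hlC using h
  set X := stack N d x with hXdef
  have hX : Measurable X := measurable_stack hxm
  let r : Ω → Fin d → ℝ := fun ω a => ell X (Pi.single (k, a) 1 - l a) ω
  have hr : Measurable r := measurable_pi_lambda _ fun a => measurable_ell hX _
  have key : ∀ U : Set ℕ, T ⊆ U → U ⊆ S → ∀ A : Set (Fin d → ℝ), MeasurableSet A →
      μ[A.indicator (fun _ => (1 : ℝ)) ∘ x k | sigmaOf x U] =ᵐ[μ]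
        fun ω => ∫ y, A.indicator (fun _ => (1 : ℝ)) (fun a => ell X (l a) ω + y a) ∂(μ.map r) := by
    intro U hTU hUS A hA
    rw [sigmaOf_eq x U (fun i hi => hS i (hUS hi))]
    have hind : IndepFun (mask X U) r μ := by
      rw [mask_eq_ell]
      refine ell_indep hC hX hg _ _ fun p a => ?_
      by_cases hp : (p.1 : ℕ) ∈ U
      · simp only [hp, if_true, single_one_dotProduct]
        exact hlC a p (hUS hp)
      · simp [hp]
    let f : (Fin (N + 1) × Fin d → ℝ) × (Fin d → ℝ) → ℝ := fun z =>
      A.indicator (fun _ => (1 : ℝ)) (fun a => (∑ p, l a p * z.1 p) + z.2 a)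
    have hf : Measurable f := (measurable_const.indicator hA).comp (by fun_prop)
    have hxk : A.indicator (fun _ => (1 : ℝ)) ∘ x k = fun ω => f (mask X U ω, r ω) := by
      funext ω
      simp only [Function.comp_apply, f]
      congr 1
      funext a
      rw [ell_mask X U (l a) (fun p hp => hl a p fun h => hp (hTU h))]
      simp only [r, ell_sub, Pi.sub_apply, ell_single]
      simp [hXdef, stack]
    rw [hxk]
    have hfi : Integrable (fun ω => f (mask X U ω, r ω)) μ := by
      refine Integrable.of_bound (C := 1)
        (hf.comp ((measurable_mask hX U).prodMk hr)).aestronglyMeasurable (ae_of_all _ fun ω => ?_)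
      simp only [f]
      refine (norm_indicator_le_norm_self _ _).trans (by simp)
    refine (condExp_indep (measurable_mask hX U) hr hind f hf.stronglyMeasurable hfi).trans
      (ae_of_all _ fun ω => ?_)
    simp only [f]
    simp only [ell_mask X U (l _) (fun p hp => hl _ p fun h => hp (hTU h))]
  intro A hA
  exact (key S hTS subset_rfl A hA).trans (key T subset_rfl hTS A hA).symm

lemma of_condEq {N d : ℕ} {μ : Measure Ω} [IsProbabilityMeasure μ] {x : ℕ → Ω → Fin d → ℝ}
    {C : Matrix (Fin (N + 1) × Fin d) (Fin (N + 1) × Fin d) ℝ}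
    (hx : ZMNG N d μ x C) (S T : Set ℕ) (hS : ∀ i ∈ S, i ≤ N) (hTS : T ⊆ S)
    (k : Fin (N + 1)) (h : CondEq μ x k S T) (v : Fin (N + 1) × Fin d → ℝ)
    (hv : ∀ p, (p.1 : ℕ) ∉ S → v p = 0) (hvT : ∀ p, (p.1 : ℕ) ∈ T → (C *ᵥ v) p = 0)
    (a : Fin d) : (C *ᵥ v) (k, a) = 0 := by
  classical
  obtain ⟨hxm, hg, hC⟩ := hx
  set X := stack N d x with hXdef
  have hX : Measurable X := measurable_stack hxm
  have hk : Measurable (x k) := hxm _ (Nat.lt_succ_iff.1 k.2)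
  set z := ell X v with hz
  have hzm : Measurable z := measurable_ell hX v
  have hz2 : MemLp z 2 μ := ell_memLp hX hg v
  have hzi : Integrable z μ := hz2.integrable (by norm_num)
  have hT : ∀ i ∈ T, i ≤ N := fun i hi => hS i (hTS hi)
  have hSle : sigmaOf x S ≤ ‹MeasurableSpace Ω› := by
    rw [sigmaOf_eq x S hS]; exact (measurable_mask hX S).comap_le
  have hTle : sigmaOf x T ≤ ‹MeasurableSpace Ω› := by
    rw [sigmaOf_eq x T hT]; exact (measurable_mask hX T).comap_le
  have hzS : StronglyMeasurable[sigmaOf x S] z := by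
    have : z = (fun y : Fin (N + 1) × Fin d → ℝ => ∑ p, v p * y p) ∘ mask X S := by
      funext ω
      exact (ell_mask X S v hv ω).symm
    rw [this, sigmaOf_eq x S hS]
    refine Measurable.stronglyMeasurable ?_
    exact Measurable.comp (by fun_prop) (comap_measurable _)
  -- conditional mean of `z` given `T` vanishes
  have hzT : μ[z | sigmaOf x T] =ᵐ[μ] fun _ => 0 := by
    have hind : IndepFun (fun ω (_ : Unit) => ell X v ω) (mask X T) μ := by
      rw [mask_eq_ell]
      refine ell_indep hC hX hg (fun _ => v) _ fun _ p => ?_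
      by_cases hp : (p.1 : ℕ) ∈ T
      · simp only [hp, if_true]
        have hsym : Cᵀ = C := by simpa using hC.isHermitian.eq
        rw [dotProduct_mulVec, ← mulVec_transpose, hsym, dotProduct_single, hvT p hp, zero_mul]
      · simp [hp]
    have hind2 : IndepFun z (mask X T) μ :=
      hind.comp (φ := fun y : Unit → ℝ => y ()) (ψ := id) (by fun_prop) measurable_id
    have h1 := condExp_indep_eq (μ := μ) (f := z) hzm.comap_le hTle
      (comap_measurable z).stronglyMeasurable (by
        rw [sigmaOf_eq x T hT]; exact hind2)
    refine h1.trans (ae_of_all _ fun _ => ?_)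
    exact ell_mean hX hg v
  -- integrals of `z` over events `{x k ∈ A}` vanish
  have hA : ∀ A : Set (Fin d → ℝ), MeasurableSet A → ∫ ω in x k ⁻¹' A, z ω ∂μ = 0 := by
    intro A hA
    set g : Ω → ℝ := A.indicator (fun _ => (1 : ℝ)) ∘ x k with hgdef
    have hgm : Measurable g := (measurable_const.indicator hA).comp hk
    have hgb : ∀ ω, ‖g ω‖ ≤ 1 := fun ω =>
      (norm_indicator_le_norm_self _ _).trans (by simp)
    have hgi : Integrable g μ :=
      Integrable.of_bound (C := 1) hgm.aestronglyMeasurable (ae_of_all _ hgb)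
    have hgz : Integrable (g * z) μ :=
      hzi.bdd_mul hgm.aestronglyMeasurable (ae_of_all _ hgb)
    have e0 : ∫ ω in x k ⁻¹' A, z ω ∂μ = ∫ ω, (g * z) ω ∂μ := by
      rw [← integral_indicator (hk hA)]
      congr 1
      funext ω
      by_cases hω : x k ω ∈ A
      · simp [hgdef, hω]
      · simp [hgdef, hω]
    have e1 : μ[g * z | sigmaOf x S] =ᵐ[μ] μ[g | sigmaOf x S] * z :=
      condExp_mul_of_stronglyMeasurable_right hzS hgz hgi
    have hb : ∀ᵐ ω ∂μ, ‖(μ[g | sigmaOf x T]) ω‖ ≤ 1 := by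
      have := ae_bdd_abs_condExp_of_ae_bdd_abs (m := sigmaOf x T) (R := 1) (μ := μ) (f := g)
        (ae_of_all _ hgb)
      exact this
    have hTz : Integrable (μ[g | sigmaOf x T] * z) μ :=
      hzi.bdd_mul (stronglyMeasurable_condExp.mono hTle).aestronglyMeasurable hb
    have e2 : μ[μ[g | sigmaOf x T] * z | sigmaOf x T] =ᵐ[μ] μ[g | sigmaOf x T] * μ[z | sigmaOf x T] :=
      condExp_mul_of_stronglyMeasurable_left stronglyMeasurable_condExp hTz hzi
    rw [e0, ← integral_condExp hSle, integral_congr_ae e1]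
    have e3 : μ[g | sigmaOf x S] * z =ᵐ[μ] μ[g | sigmaOf x T] * z := by
      filter_upwards [h A hA] with ω hω
      simp only [Pi.mul_apply]
      rw [hω]
    rw [integral_congr_ae e3, ← integral_condExp hTle, integral_congr_ae e2]
    apply integral_eq_zero_of_ae
    filter_upwards [hzT] with ω hω
    simp [hω]
  have hkle : MeasurableSpace.comap (x k) inferInstance ≤ ‹MeasurableSpace Ω› := hk.comap_le
  have hzk : (fun _ => (0 : ℝ)) =ᵐ[μ] μ[z | MeasurableSpace.comap (x k) inferInstance] := by
    refine ae_eq_condExp_of_forall_setIntegral_eq hkle hzi (fun s _ _ => by simp)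
      ?_ aestronglyMeasurable_const
    rintro s ⟨A, hAm, rfl⟩ _
    rw [hA A hAm]; simp
  set y := ell X (Pi.single (k, a) 1) with hy
  have hyk : y = (fun w : Fin d → ℝ => w a) ∘ x k := by
    funext ω
    simp [hy, ell_single, hXdef, stack]
  have hyS : StronglyMeasurable[MeasurableSpace.comap (x k) inferInstance] y := by
    rw [hyk]
    refine Measurable.stronglyMeasurable ?_
    exact Measurable.comp (measurable_pi_apply a) (comap_measurable (x k))
  have hy2 : MemLp y 2 μ := ell_memLp hX hg _
  have hyz : Integrable (y * z) μ := hy2.integrable_mul hz2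
  have e4 : μ[y * z | MeasurableSpace.comap (x k) inferInstance] =ᵐ[μ]
      y * μ[z | MeasurableSpace.comap (x k) inferInstance] :=
    condExp_mul_of_stronglyMeasurable_left hyS hyz hzi
  have e5 : ∫ ω, (y * z) ω ∂μ = 0 := by
    rw [← integral_condExp hkle, integral_congr_ae e4]
    apply integral_eq_zero_of_ae
    filter_upwards [hzk] with ω hω
    simp [← hω]
  have e6 := ell_cov hC hX hg (Pi.single (k, a) 1) v
  rw [covariance_eq_sub hy2 hz2, e5, ell_mean hX hg v, mul_zero, sub_zero,
    single_one_dotProduct] at e6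
  exact e6.symm

theorem stmt1 {N d : ℕ} (hN : 3 ≤ N) (hd : 1 ≤ d)
    (μ : Measure Ω) [IsProbabilityMeasure μ] (x : ℕ → Ω → Fin d → ℝ)
    (C : Matrix (Fin (N + 1) × Fin d) (Fin (N + 1) × Fin d) ℝ)
    (hx : ZMNG N d μ x C) (c : ℕ) (hc : c = 0 ∨ c = N) :
    IsCM μ x 0 N c ↔ (if c = 0 then HasCMFForm C⁻¹ else HasCMLForm C⁻¹) := by
  have hform : (if c = 0 then HasCMFForm C⁻¹ else HasCMLForm C⁻¹) ↔
      ∀ i j : Fin (N + 1), Far i j → (i : ℕ) ≠ c → (j : ℕ) ≠ c → BlockZero C⁻¹ i j := by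
    rcases hc with rfl | rfl
    · simp [HasCMFForm]
    · rw [if_neg (by omega)]
      simp [HasCMLForm]
  rw [hform]
  have hcN : c ≤ N := by omega
  have hC : C.PosDef := hx.2.2
  have hS : ∀ j, j ≤ N → ∀ i ∈ Set.Icc 0 j ∪ {c}, i ≤ N := by
    intro j hj i hi
    simp only [Set.mem_union, Set.mem_Icc, Set.mem_singleton_iff] at hi
    omega
  have hTS : ∀ j, ({j} ∪ {c} : Set ℕ) ⊆ Set.Icc 0 j ∪ {c} := by
    intro j i hi
    simp only [Set.mem_union, Set.mem_Icc, Set.mem_singleton_iff] at hi ⊢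
    omega
  have hsym : ∀ p q, C⁻¹ p q = C⁻¹ q p := by
    intro p q
    have := hC.inv.isHermitian.apply q p
    simpa using this
  constructor
  · intro h
    have main : ∀ i j : Fin (N + 1), (i : ℕ) + 2 ≤ j → (i : ℕ) ≠ c → (j : ℕ) ≠ c →
        ∀ a b, C⁻¹ (j, a) (i, b) = 0 := by
      intro i j hij hic hjc a b
      have hjN := j.2
      refine lin1 hC (fun p => (p.1 : ℕ) < i + 1 ∧ (p.1 : ℕ) ≠ c)
        (fun p => (p.1 : ℕ) = i + 1 ∨ (p.1 : ℕ) = c) (by intro p; omega) ?_ (i, b)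
        ⟨by simp, hic⟩ (j, a) (by simp only; omega)
      intro v hv hvT k hk
      have hkN := k.1.2
      refine of_condEq hx (Set.Icc 0 ((i : ℕ) + 1) ∪ {c}) ({(i : ℕ) + 1} ∪ {c})
        (hS _ (by omega)) (hTS _) k.1
        (h (i + 1) k.1 (by omega) (by omega) (by omega)) v ?_ ?_ k.2
      · intro p hp
        apply hv
        simp only [Set.mem_union, Set.mem_Icc, Set.mem_singleton_iff] at hp
        omega
      · intro p hp
        apply hvT
        simpa only [Set.mem_union, Set.mem_singleton_iff] using hp
    intro i j hij hic hjc a b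
    rcases hij with hij | hij
    · rw [hsym]; exact main i j hij hic hjc b a
    · exact main j i hij hjc hic a b
  · intro h j k _ hjk hkN
    have hkk : ((⟨k, by omega⟩ : Fin (N + 1)) : ℕ) = k := rfl
    rw [← hkk]
    refine condEq_of hx _ _ (hS j (by omega)) (hTS j) _ fun a => ?_
    obtain ⟨l, hl, hlC⟩ := lin2 hC (fun p => (p.1 : ℕ) < j ∧ (p.1 : ℕ) ≠ c)
      (fun p => (p.1 : ℕ) = j ∨ (p.1 : ℕ) = c) (by intro p; omega) (by
        intro i hi q hq
        refine h q.1 i.1 (Or.inr (by omega)) (by omega) (by omega) q.2 i.2)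
      (⟨k, by omega⟩, a) (by simp only; omega)
    refine ⟨l, fun p hp => hl p ?_, fun q hq => hlC q ?_⟩
    · simpa only [Set.mem_union, Set.mem_singleton_iff] using hp
    · simp only [Set.mem_union, Set.mem_Icc, Set.mem_singleton_iff] at hq
      omega

end CMSeqPaper
end

section
/- A zero-mean nonsingular Gaussian sequence [x_k], k ∈ [0,N], with covariance matrix C is reciprocal if and only if C⁻¹ is cyclic block tri-diagonal (equivalently, C⁻¹ has both the CM_L and the CM_F form). -/
open MeasureTheory ProbabilityTheory Matrix
open scoped NNReal

namespace CMSeqPaper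

variable {Ω : Type*} [MeasurableSpace Ω]

section Helpers

theorem aux_gaussLaw {ι : Type*} [Fintype ι] {μ : Measure Ω}
    {X : Ω → ι → ℝ} {C : Matrix ι ι ℝ} (hXm : Measurable X)
    (h : IsZeroMeanGaussian μ X C) : HasGaussianLaw X μ := by
  classical
  refine ⟨isGaussian_of_map_eq_gaussianReal fun L => ?_⟩
  refine ⟨0, ((fun i => L (Pi.single i 1)) ⬝ᵥ C.mulVec (fun i => L (Pi.single i 1))).toNNReal, ?_⟩
  · rw [Measure.map_map (by fun_prop) hXm, ← h (fun i => L (Pi.single i 1))]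
    congr 1
    funext ω
    simp only [Function.comp_apply]
    conv_lhs => rw [← LinearMap.sum_single_apply (fun _ : ι => ℝ) (X ω)]
    rw [map_sum]
    refine Finset.sum_congr rfl fun i _ => ?_
    have : (Pi.single i (X ω i) : ι → ℝ) = X ω i • Pi.single i (1 : ℝ) := by
      rw [← Pi.single_smul]; simp
    rw [this, map_smul, smul_eq_mul, mul_comm]

theorem aux_memLp {ι : Type*} [Fintype ι] {μ : Measure Ω}
    {X : Ω → ι → ℝ} {C : Matrix ι ι ℝ} (hXm : Measurable X)
    (h : IsZeroMeanGaussian μ X C) (l : ι → ℝ) :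
    MemLp (fun ω => l ⬝ᵥ X ω) 2 μ := by
  have h1 := (aux_gaussLaw hXm h).memLp_two
  unfold dotProduct
  refine memLp_finsetSum _ fun i _ => ?_
  exact (MemLp.eval h1 i).const_mul (l i)

theorem aux_mean {ι : Type*} [Fintype ι] {μ : Measure Ω}
    {X : Ω → ι → ℝ} {C : Matrix ι ι ℝ} (hXm : Measurable X)
    (h : IsZeroMeanGaussian μ X C) (l : ι → ℝ) :
    ∫ ω, l ⬝ᵥ X ω ∂μ = 0 := by
  have hm : Measurable (fun ω => l ⬝ᵥ X ω) := by unfold dotProduct; fun_prop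
  have := integral_map (μ := μ) hm.aemeasurable (f := fun y : ℝ => y) (by fun_prop)
  rw [← this]
  have h2 := h l
  change μ.map (fun ω => l ⬝ᵥ X ω) = _ at h2
  rw [h2, integral_id_gaussianReal]

theorem aux_var {ι : Type*} [Fintype ι] {μ : Measure Ω}
    {X : Ω → ι → ℝ} {C : Matrix ι ι ℝ} (hXm : Measurable X)
    (h : IsZeroMeanGaussian μ X C) (hC : C.PosDef) (l : ι → ℝ) :
    Var[fun ω => l ⬝ᵥ X ω; μ] = l ⬝ᵥ C *ᵥ l := by
  have hm : Measurable (fun ω => l ⬝ᵥ X ω) := by unfold dotProduct; fun_prop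
  have := variance_map (μ := μ) (X := fun y : ℝ => y) (Y := fun ω => l ⬝ᵥ X ω) (by fun_prop)
    hm.aemeasurable
  have h2 := h l
  change μ.map (fun ω => l ⬝ᵥ X ω) = _ at h2
  rw [h2] at this
  have h3 := variance_id_gaussianReal (μ := 0) (v := (l ⬝ᵥ C *ᵥ l).toNNReal)
  have h4 : Var[fun ω => l ⬝ᵥ X ω; μ] = ((l ⬝ᵥ C *ᵥ l).toNNReal : ℝ) := by
    rw [← h3]; exact this.symm
  rw [h4, Real.coe_toNNReal]
  have := hC.posSemidef.dotProduct_mulVec_nonneg l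
  simpa using this

theorem aux_cov {ι : Type*} [Fintype ι] {μ : Measure Ω} [IsProbabilityMeasure μ]
    {X : Ω → ι → ℝ} {C : Matrix ι ι ℝ} (hXm : Measurable X)
    (h : IsZeroMeanGaussian μ X C) (hC : C.PosDef) (l m : ι → ℝ) :
    cov[fun ω => l ⬝ᵥ X ω, fun ω => m ⬝ᵥ X ω; μ] = m ⬝ᵥ C *ᵥ l := by
  have h1 := variance_add (aux_memLp hXm h l) (aux_memLp hXm h m)
  have h2 : (fun ω => l ⬝ᵥ X ω) + (fun ω => m ⬝ᵥ X ω) = fun ω => (l + m) ⬝ᵥ X ω := by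
    funext ω; simp [add_dotProduct]
  rw [h2, aux_var hXm h hC, aux_var hXm h hC, aux_var hXm h hC] at h1
  have h3 : l ⬝ᵥ C *ᵥ m = m ⬝ᵥ C *ᵥ l := by
    have hs : Cᵀ = C := by 
      have h5 := hC.1
      rwa [IsHermitian, conjTranspose_eq_transpose_of_trivial] at h5
    rw [dotProduct_mulVec, ← mulVec_transpose, hs, dotProduct_comm]
  simp only [add_dotProduct, mulVec_add, dotProduct_add] at h1
  linarith

theorem aux_lin_zero {ι : Type*} [Fintype ι] {μ : Measure Ω} [IsProbabilityMeasure μ]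
    {X : Ω → ι → ℝ} {C : Matrix ι ι ℝ} (hXm : Measurable X)
    (h : IsZeroMeanGaussian μ X C) (hC : C.PosDef) (l : ι → ℝ)
    (h0 : (fun ω => l ⬝ᵥ X ω) =ᵐ[μ] 0) : l = 0 := by
  have h1 := aux_var hXm h hC l
  rw [variance_congr h0, variance_zero] at h1
  by_contra hl
  have := hC.dotProduct_mulVec_pos hl
  simp only [star_trivial] at this
  linarith

theorem aux_regress {ι : Type*} [Fintype ι] {C : Matrix ι ι ℝ} (hC : C.PosDef)
    (S : Set ι) (v : ι → ℝ) :
    ∃ c : ι → ℝ, (∀ i, i ∉ S → c i = 0) ∧ ∀ i ∈ S, (C *ᵥ (v - c)) i = 0 := by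
  classical
  have hS := hC.submatrix (e := (Subtype.val : S → ι)) Subtype.val_injective
  have hu : IsUnit (C.submatrix (Subtype.val : S → ι) Subtype.val).det :=
    (Matrix.isUnit_iff_isUnit_det _).1 hS.isUnit
  set B := C.submatrix (Subtype.val : S → ι) Subtype.val with hB
  set w : S → ℝ := B⁻¹ *ᵥ (fun i => (C *ᵥ v) i) with hw
  refine ⟨fun i => if hi : i ∈ S then w ⟨i, hi⟩ else 0, fun i hi => by simp [hi], fun i hi => ?_⟩
  have h1 : B *ᵥ w = fun i : S => (C *ᵥ v) i := by
    rw [hw, mulVec_mulVec, mul_nonsing_inv _ hu, one_mulVec]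
  have h2 := congrFun h1 ⟨i, hi⟩
  rw [mulVec_sub, Pi.sub_apply, ← h2, sub_eq_zero]
  simp only [mulVec, dotProduct, hB, submatrix_apply]
  set g : ι → ℝ := fun j => C i j * (if hj : j ∈ S then w ⟨j, hj⟩ else 0) with hg
  have e1 : ∑ j : S, C i j * w j = ∑ j : S, g j :=
    Finset.sum_congr rfl fun j _ => by simp [hg]
  have e2 : ∑ j ∈ S.toFinset, g j = ∑ j : S, g j :=
    Finset.sum_subtype _ (fun j => by simp) _
  have e3 : ∑ j ∈ S.toFinset, g j = ∑ j, g j :=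
    Finset.sum_subset (Finset.subset_univ _) fun j _ hj => by
      have : j ∉ S := by simpa using hj
      simp [hg, this]
  exact (e1.trans (e2.symm.trans e3))

theorem aux_indep {ι κ : Type*} [Fintype ι] [Finite κ] {μ : Measure Ω} [IsProbabilityMeasure μ]
    {X : Ω → ι → ℝ} {C : Matrix ι ι ℝ} (hXm : Measurable X)
    (h : IsZeroMeanGaussian μ X C) (hC : C.PosDef) (S : Set ι) (U : κ → ι → ℝ)
    (hU : ∀ a, ∀ i ∈ S, (C *ᵥ U a) i = 0) :
    IndepFun (fun ω a => U a ⬝ᵥ X ω) (fun ω (i : S) => X ω i) μ := by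
  classical
  have := Fintype.ofFinite κ
  refine HasGaussianLaw.indepFun_of_covariance_eval (X := fun a ω => U a ⬝ᵥ X ω)
    (Y := fun (i : S) ω => X ω i) ?_ ?_
  · let L : (ι → ℝ) →ₗ[ℝ] (κ → ℝ) × (S → ℝ) :=
      { toFun := fun y => (fun a => U a ⬝ᵥ y, fun i => y i)
        map_add' := by intro y z; ext <;> simp [dotProduct_add]
        map_smul' := by intro y z; ext <;> simp [dotProduct_smul] }
    exact (aux_gaussLaw hXm h).map_fun (LinearMap.toContinuousLinearMap L)
  · intro a i
    have := aux_cov hXm h hC (U a) (Pi.single i.1 1)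
    simp only [single_one_dotProduct] at this
    rw [this, hU a i i.2]

theorem aux_condExp {Ωs E : Type*} [AddCommGroup E] [MeasurableSpace E] [MeasurableAdd₂ E]
    {m m0 : MeasurableSpace Ωs} (hm : m ≤ m0) (μ : Measure Ωs)
    [IsProbabilityMeasure μ] {Y e : Ωs → E} (hY : Measurable[m] Y) (he : Measurable e)
    (hind : Indep (MeasurableSpace.comap e inferInstance) m μ) (A : Set E)
    (hA : MeasurableSet A) :
    μ[A.indicator (fun _ => (1 : ℝ)) ∘ (fun ω => Y ω + e ω) | m] =ᵐ[μ]
      fun ω => ∫ z, A.indicator (fun _ => (1 : ℝ)) (Y ω + z) ∂(μ.map e) := by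
  have hY0 : Measurable Y := hY.mono hm le_rfl
  have hpe : IsProbabilityMeasure (μ.map e) := Measure.isProbabilityMeasure_map he.aemeasurable
  set f : E → ℝ := A.indicator (fun _ => (1 : ℝ)) with hf
  have hfm : Measurable f := measurable_const.indicator hA
  have hfb : ∀ y, ‖f y‖ ≤ 1 := by
    intro y; by_cases hy : y ∈ A <;> simp [hf, hy]
  have hgm : Measurable (fun y => ∫ z, f (y + z) ∂(μ.map e)) := by
    have : StronglyMeasurable (fun p : E × E => f (p.1 + p.2)) :=
      (hfm.comp (measurable_fst.add measurable_snd)).stronglyMeasurable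
    exact (this.integral_prod_right' (ν := μ.map e)).measurable
  have hgb : ∀ y, ‖∫ z, f (y + z) ∂(μ.map e)‖ ≤ 1 := by
    intro y
    have := norm_integral_le_of_norm_le_const (μ := μ.map e) (f := fun z => f (y + z))
      (C := 1) (ae_of_all _ fun z => hfb _)
    simpa using this
  have hfi : Integrable (f ∘ fun ω => Y ω + e ω) μ :=
    Integrable.of_bound (hfm.comp (hY0.add he)).aestronglyMeasurable 1 (ae_of_all _ fun _ => hfb _)
  have hgi : Integrable (fun ω => ∫ z, f (Y ω + z) ∂(μ.map e)) μ :=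
    Integrable.of_bound (hgm.comp hY0).aestronglyMeasurable 1 (ae_of_all _ fun _ => hgb _)
  refine (ae_eq_condExp_of_forall_setIntegral_eq hm hfi (fun s _ _ => hgi.integrableOn) ?_
    (hgm.comp hY).aestronglyMeasurable).symm
  intro s hs _
  set W : Ωs → ℝ × E := fun ω => (s.indicator (fun _ => (1 : ℝ)) ω, Y ω) with hW
  have hWm : Measurable[m] W := (measurable_const.indicator hs).prodMk hY
  have hWm0 : Measurable W := hWm.mono hm le_rfl
  have hWe : IndepFun W e μ := by
    rw [IndepFun_iff_Indep]
    exact (indep_of_indep_of_le_right hind hWm.comap_le).symm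
  have hprod := (indepFun_iff_map_prod_eq_prod_map_map hWm0.aemeasurable he.aemeasurable).1 hWe
  have hpW : IsProbabilityMeasure (μ.map W) := Measure.isProbabilityMeasure_map hWm0.aemeasurable
  have hHm : Measurable (fun p : (ℝ × E) × E => p.1.1 * f (p.1.2 + p.2)) := by
    have : Measurable (fun p : (ℝ × E) × E => p.1.2 + p.2) :=
      (measurable_snd.comp measurable_fst).add measurable_snd
    exact (measurable_fst.comp measurable_fst).mul (hfm.comp this)
  have hsi : ∀ (F : Ωs → ℝ), ∫ ω in s, F ω ∂μ = ∫ ω, (W ω).1 * F ω ∂μ := by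
    intro F
    rw [← integral_indicator (hm _ hs)]
    congr 1
    funext ω
    by_cases hω : ω ∈ s <;> simp [hW, hω]
  rw [hsi, hsi]
  have e1 : ∫ ω, (W ω).1 * (f ∘ fun ω => Y ω + e ω) ω ∂μ
      = ∫ p, p.1.1 * f (p.1.2 + p.2) ∂((μ.map W).prod (μ.map e)) := by
    rw [← hprod, integral_map (hWm0.prodMk he).aemeasurable hHm.aestronglyMeasurable]
    rfl
  have hHi : Integrable (fun p : (ℝ × E) × E => p.1.1 * f (p.1.2 + p.2))
      ((μ.map W).prod (μ.map e)) := by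
    rw [← hprod, integrable_map_measure hHm.aestronglyMeasurable (hWm0.prodMk he).aemeasurable]
    refine Integrable.of_bound (hHm.comp (hWm0.prodMk he)).aestronglyMeasurable 1
      (ae_of_all _ fun ω => ?_)
    by_cases hω : ω ∈ s
    · simpa [hW, hω] using hfb (Y ω + e ω)
    · simp [hW, hω]
  rw [e1, integral_prod _ hHi, integral_map hWm0.aemeasurable]
  · refine integral_congr_ae (ae_of_all _ fun ω => ?_)
    simp only [integral_const_mul]
    rfl
  · exact (hHm.stronglyMeasurable.integral_prod_right' (ν := μ.map e)).aestronglyMeasurable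

theorem aux_condExp_fun {Ωs E : Type*} [MeasurableSpace E]
    {m₁ m₂ m0 : MeasurableSpace Ωs} (h₁ : m₁ ≤ m0) (h₂ : m₂ ≤ m0) (μ : Measure Ωs)
    [IsProbabilityMeasure μ] {X : Ωs → E} (hX : Measurable X)
    (h : ∀ A : Set E, MeasurableSet A → μ[A.indicator (fun _ => (1 : ℝ)) ∘ X | m₁] =ᵐ[μ]
      μ[A.indicator (fun _ => (1 : ℝ)) ∘ X | m₂]) (f : E → ℝ) (hf : Measurable f)
    (hfi : Integrable (f ∘ X) μ) : μ[f ∘ X | m₁] =ᵐ[μ] μ[f ∘ X | m₂] := by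
  refine MemLp.induction_stronglyMeasurable (μ := μ) (p := 1) hX.comap_le ENNReal.one_ne_top
    (fun g : Ωs → ℝ => μ[g | m₁] =ᵐ[μ] μ[g | m₂]) ?_ ?_ ?_ ?_
    (memLp_one_iff_integrable.2 hfi) ?_
  · rintro c s ⟨A, hA, rfl⟩ _
    have e1 : (X ⁻¹' A).indicator (fun _ => c) = c • (A.indicator (fun _ => (1 : ℝ)) ∘ X) := by
      funext ω
      by_cases hω : X ω ∈ A <;> simp [hω]
    rw [e1]
    filter_upwards [condExp_smul c (A.indicator (fun _ => (1 : ℝ)) ∘ X) m₁ (μ := μ),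
      condExp_smul c (A.indicator (fun _ => (1 : ℝ)) ∘ X) m₂ (μ := μ), h A hA] with ω a1 a2 a3
    rw [a1, a2, Pi.smul_apply, Pi.smul_apply, a3]
  · intro u v _ hu hv _ _ hu' hv'
    rw [memLp_one_iff_integrable] at hu hv
    filter_upwards [condExp_add hu hv m₁, condExp_add hu hv m₂, hu', hv'] with ω a1 a2 a3 a4
    rw [a1, a2, Pi.add_apply, Pi.add_apply, a3, a4]
  · have : {g : lpMeas ℝ ℝ (MeasurableSpace.comap X inferInstance) 1 μ |
        μ[((g : Lp ℝ 1 μ) : Ωs → ℝ) | m₁] =ᵐ[μ] μ[((g : Lp ℝ 1 μ) : Ωs → ℝ) | m₂]} =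
        {g : lpMeas ℝ ℝ (MeasurableSpace.comap X inferInstance) 1 μ | condExpL1CLM ℝ h₁ μ (g : Lp ℝ 1 μ) = condExpL1CLM ℝ h₂ μ (g : Lp ℝ 1 μ)} := by
      ext g
      have i := L1.integrable_coeFn (g : Lp ℝ 1 μ)
      have b1 := condExp_ae_eq_condExpL1CLM h₁ i
      have b2 := condExp_ae_eq_condExpL1CLM h₂ i
      rw [Integrable.toL1_coeFn] at b1 b2
      simp only [Set.mem_ofPred_eq]
      constructor
      · intro hh
        exact Lp.ext (b1.symm.trans (hh.trans b2))
      · intro hh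
        rw [hh] at b1
        exact b1.trans b2.symm
    rw [this]
    exact isClosed_eq ((condExpL1CLM ℝ h₁ μ).continuous.comp continuous_subtype_val)
      ((condExpL1CLM ℝ h₂ μ).continuous.comp continuous_subtype_val)
  · intro u v huv _ hu
    exact (condExp_congr_ae huv).symm.trans (hu.trans (condExp_congr_ae huv))
  · exact (hf.comp (comap_measurable X)).aestronglyMeasurable

/-- Stacked indices whose time lies in `S`. -/
def idx (N d : ℕ) (S : Set ℕ) : Set (Fin (N + 1) × Fin d) := {p | (p.1 : ℕ) ∈ S}

theorem aux_stack_meas {N d : ℕ} {x : ℕ → Ω → Fin d → ℝ}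
    (hm : ∀ k, k ≤ N → Measurable (x k)) : Measurable (stack N d x) := by
  refine measurable_pi_lambda _ fun p => ?_
  exact (measurable_pi_apply p.2).comp (hm p.1 (Nat.lt_succ_iff.1 p.1.2))

theorem aux_sigma_le {N d : ℕ} {x : ℕ → Ω → Fin d → ℝ}
    (hm : ∀ k, k ≤ N → Measurable (x k)) {S : Set ℕ} (hS : ∀ i ∈ S, i ≤ N) :
    sigmaOf x S ≤ (inferInstance : MeasurableSpace Ω) :=
  iSup₂_le fun i hi => (hm i (hS i hi)).comap_le

theorem aux_sigma_mono {d : ℕ} {x : ℕ → Ω → Fin d → ℝ} {S T : Set ℕ} (h : T ⊆ S) :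
    sigmaOf x T ≤ sigmaOf x S :=
  biSup_mono h

theorem aux_sigma_le_comap {N d : ℕ} {x : ℕ → Ω → Fin d → ℝ} {S : Set ℕ}
    (hS : ∀ i ∈ S, i ≤ N) :
    sigmaOf x S ≤ MeasurableSpace.comap
      (fun ω (p : idx N d S) => stack N d x ω p) inferInstance := by
  refine iSup₂_le fun i hi => ?_
  rw [← measurable_iff_comap_le]
  refine @measurable_pi_lambda _ _ _ (MeasurableSpace.comap
    (fun ω (p : idx N d S) => stack N d x ω p) inferInstance) _ _ fun a => ?_
  have h := comap_measurable (m := MeasurableSpace.pi) (fun ω (p : idx N d S) => stack N d x ω p)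
  exact (measurable_pi_apply
    (⟨(⟨i, Nat.lt_succ_of_le (hS i hi)⟩, a), hi⟩ : idx N d S)).comp h

theorem aux_lin_meas {N d : ℕ} {x : ℕ → Ω → Fin d → ℝ} {S : Set ℕ}
    {c : Fin (N + 1) × Fin d → ℝ} (hc : ∀ p, p ∉ idx N d S → c p = 0) :
    Measurable[sigmaOf x S] (fun ω => c ⬝ᵥ stack N d x ω) := by
  unfold dotProduct
  refine Finset.measurable_sum _ fun p _ => ?_
  by_cases hp : p ∈ idx N d S
  · refine Measurable.const_mul ?_ _
    have h1 : MeasurableSpace.comap (x p.1) inferInstance ≤ sigmaOf x S :=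
      le_iSup₂ (f := fun i (_ : i ∈ S) => MeasurableSpace.comap (x i) inferInstance) (p.1 : ℕ) hp
    have h2 : Measurable[sigmaOf x S] (x p.1) := measurable_iff_comap_le.2 h1
    exact (measurable_pi_apply p.2).comp h2
  · simp only [hc p hp, zero_mul]
    exact measurable_const

theorem aux_resid_indep {N d : ℕ} {μ : Measure Ω} [IsProbabilityMeasure μ]
    {x : ℕ → Ω → Fin d → ℝ} {C : Matrix (Fin (N + 1) × Fin d) (Fin (N + 1) × Fin d) ℝ}
    (hx : ZMNG N d μ x C) {S : Set ℕ} (hS : ∀ i ∈ S, i ≤ N)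
    {κ : Type*} [Finite κ] (U : κ → Fin (N + 1) × Fin d → ℝ)
    (hU : ∀ a, ∀ p ∈ idx N d S, (C *ᵥ U a) p = 0) :
    Indep (MeasurableSpace.comap (fun ω a => U a ⬝ᵥ stack N d x ω) inferInstance)
      (sigmaOf x S) μ := by
  have h := aux_indep (aux_stack_meas hx.1) hx.2.1 hx.2.2 (idx N d S) U hU
  rw [IndepFun_iff_Indep] at h
  exact indep_of_indep_of_le_right h (aux_sigma_le_comap hS)

theorem aux_condEq {N d : ℕ} {μ : Measure Ω} [IsProbabilityMeasure μ]
    {x : ℕ → Ω → Fin d → ℝ} {C : Matrix (Fin (N + 1) × Fin d) (Fin (N + 1) × Fin d) ℝ}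
    (hx : ZMNG N d μ x C) {S T : Set ℕ} (hS : ∀ i ∈ S, i ≤ N) (hTS : T ⊆ S)
    (k : Fin (N + 1)) (c : Fin d → Fin (N + 1) × Fin d → ℝ)
    (hc : ∀ a p, p ∉ idx N d T → c a p = 0)
    (hU : ∀ a, ∀ p ∈ idx N d S, (C *ᵥ (Pi.single (k, a) 1 - c a)) p = 0) :
    CondEq μ x k S T := by
  intro A hA
  have hXm := aux_stack_meas hx.1
  have hT : ∀ i ∈ T, i ≤ N := fun i hi => hS i (hTS hi)
  have hI := aux_resid_indep hx hS (fun a => Pi.single (k, a) 1 - c a) hU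
  have hIT := indep_of_indep_of_le_right hI (aux_sigma_mono (x := x) hTS)
  have hYT : Measurable[sigmaOf x T] (fun ω a => c a ⬝ᵥ stack N d x ω) :=
    @measurable_pi_lambda _ _ _ (sigmaOf x T) _ _ fun a => aux_lin_meas (hc a)
  have hYS := hYT.mono (aux_sigma_mono (x := x) hTS) le_rfl
  have he : Measurable (fun ω (a : Fin d) => (Pi.single (k, a) 1 - c a) ⬝ᵥ stack N d x ω) := by
    refine measurable_pi_lambda _ fun a => ?_
    unfold dotProduct
    fun_prop
  have hsum : x k = fun ω => (fun a => c a ⬝ᵥ stack N d x ω) +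
      (fun (a : Fin d) => (Pi.single (k, a) 1 - c a) ⬝ᵥ stack N d x ω) := by
    funext ω a
    simp [sub_dotProduct, stack]
  rw [hsum]
  exact (aux_condExp (aux_sigma_le hx.1 hS) μ hYS he hI A hA).trans
    (aux_condExp (aux_sigma_le hx.1 hT) μ hYT he hIT A hA).symm

theorem aux_condMean {N d : ℕ} {μ : Measure Ω} [IsProbabilityMeasure μ]
    {x : ℕ → Ω → Fin d → ℝ} {C : Matrix (Fin (N + 1) × Fin d) (Fin (N + 1) × Fin d) ℝ}
    (hx : ZMNG N d μ x C) {S : Set ℕ} (hS : ∀ i ∈ S, i ≤ N)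
    (v c : Fin (N + 1) × Fin d → ℝ)
    (hc : ∀ p, p ∉ idx N d S → c p = 0)
    (hU : ∀ p ∈ idx N d S, (C *ᵥ (v - c)) p = 0) :
    μ[fun ω => v ⬝ᵥ stack N d x ω | sigmaOf x S] =ᵐ[μ] fun ω => c ⬝ᵥ stack N d x ω := by
  have hXm := aux_stack_meas hx.1
  have hle := aux_sigma_le hx.1 hS
  have hI := aux_resid_indep hx hS (fun _ : Unit => v - c) (fun _ => hU)
  have hint : ∀ l : Fin (N + 1) × Fin d → ℝ, Integrable (fun ω => l ⬝ᵥ stack N d x ω) μ :=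
    fun l => (aux_memLp hXm hx.2.1 l).integrable one_le_two
  have he : Measurable (fun ω (_ : Unit) => (v - c) ⬝ᵥ stack N d x ω) := by
    refine measurable_pi_lambda _ fun a => ?_
    unfold dotProduct
    fun_prop
  have h1 : μ[fun ω => (v - c) ⬝ᵥ stack N d x ω | sigmaOf x S] =ᵐ[μ] fun _ => 0 := by
    have := condExp_indep_eq (μ := μ) (f := fun ω => (v - c) ⬝ᵥ stack N d x ω)
      he.comap_le hle
      ((measurable_pi_apply ()).comp (comap_measurable
        (fun ω (_ : Unit) => (v - c) ⬝ᵥ stack N d x ω))).stronglyMeasurable hI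
    rwa [aux_mean hXm hx.2.1] at this
  have h2 : μ[fun ω => c ⬝ᵥ stack N d x ω | sigmaOf x S] = fun ω => c ⬝ᵥ stack N d x ω :=
    condExp_of_stronglyMeasurable hle (aux_lin_meas hc).stronglyMeasurable (hint c)
  have hsum : (fun ω => v ⬝ᵥ stack N d x ω) =
      (fun ω => c ⬝ᵥ stack N d x ω) + (fun ω => (v - c) ⬝ᵥ stack N d x ω) := by
    funext ω
    simp [sub_dotProduct]
  rw [hsum]
  filter_upwards [condExp_add (hint c) (hint (v - c)) (sigmaOf x S), h1] with ω a1 a2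
  rw [a1, Pi.add_apply, a2, h2, add_zero]

theorem aux_coeff_eq {N d : ℕ} {μ : Measure Ω} [IsProbabilityMeasure μ]
    {x : ℕ → Ω → Fin d → ℝ} {C : Matrix (Fin (N + 1) × Fin d) (Fin (N + 1) × Fin d) ℝ}
    (hx : ZMNG N d μ x C) {S T : Set ℕ} (hS : ∀ i ∈ S, i ≤ N) (hT : ∀ i ∈ T, i ≤ N)
    (k : Fin (N + 1)) (a : Fin d) (h : CondEq μ x k S T) :
    ∃ c : Fin (N + 1) × Fin d → ℝ, (∀ p, p ∉ idx N d T → c p = 0) ∧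
      ∀ p ∈ idx N d S, (C *ᵥ (Pi.single (k, a) 1 - c)) p = 0 := by
  have hXm := aux_stack_meas hx.1
  obtain ⟨c, hc1, hc2⟩ := aux_regress hx.2.2 (idx N d S) (Pi.single (k, a) 1)
  obtain ⟨c', hc1', hc2'⟩ := aux_regress hx.2.2 (idx N d T) (Pi.single (k, a) 1)
  have h1 := aux_condMean hx hS _ c hc1 hc2
  have h2 := aux_condMean hx hT _ c' hc1' hc2'
  have hv : (fun ω => (Pi.single (k, a) 1 : Fin (N + 1) × Fin d → ℝ) ⬝ᵥ stack N d x ω) =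
      (fun y : Fin d → ℝ => y a) ∘ x k := by
    funext ω
    simp [stack]
  have hint := (aux_memLp hXm hx.2.1 (Pi.single (k, a) 1)).integrable one_le_two
  rw [hv] at h1 h2 hint
  have h3 := aux_condExp_fun (aux_sigma_le hx.1 hS) (aux_sigma_le hx.1 hT) μ
    (hx.1 k (Nat.lt_succ_iff.1 k.2)) h (fun y => y a) (measurable_pi_apply a) hint
  have h4 : c - c' = 0 := by
    apply aux_lin_zero hXm hx.2.1 hx.2.2
    filter_upwards [h1, h2, h3] with ω a1 a2 a3
    rw [sub_dotProduct, ← a1, ← a2, a3]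
    simp
  have h5 : c = c' := sub_eq_zero.1 h4
  exact ⟨c, h5 ▸ hc1', hc2⟩


theorem aux_inv_apply {ι : Type*} [Fintype ι] [DecidableEq ι] {C : Matrix ι ι ℝ}
    (hC : C.PosDef) (u : ι → ℝ) : C⁻¹ *ᵥ (C *ᵥ u) = u := by
  rw [mulVec_mulVec, nonsing_inv_mul _ ((Matrix.isUnit_iff_isUnit_det _).1 hC.isUnit), one_mulVec]

theorem aux_inv_symm {ι : Type*} [Fintype ι] [DecidableEq ι] {C : Matrix ι ι ℝ}
    (hC : C.PosDef) (i j : ι) : C⁻¹ i j = C⁻¹ j i := by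
  have h := hC.inv.1
  rw [IsHermitian, conjTranspose_eq_transpose_of_trivial] at h
  exact congrFun (congrFun h j) i

theorem aux_forward_block {N d : ℕ} {μ : Measure Ω} [IsProbabilityMeasure μ]
    {x : ℕ → Ω → Fin d → ℝ} {C : Matrix (Fin (N + 1) × Fin d) (Fin (N + 1) × Fin d) ℝ}
    (hx : ZMNG N d μ x C) (hr : IsReciprocal μ x N) (s k : Fin (N + 1))
    (hk0 : (k : ℕ) ≠ 0) (hkN : (k : ℕ) ≠ N) (hf : Far s k) : BlockZero C⁻¹ s k := by
  have hkl := k.2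
  have hce := hr (k - 1) k (k + 1) (by omega) (by omega) (by omega)
  set S : Set ℕ := Set.Icc 0 ((k : ℕ) - 1) ∪ Set.Icc ((k : ℕ) + 1) N with hSdef
  set T : Set ℕ := {(k : ℕ) - 1} ∪ {(k : ℕ) + 1} with hTdef
  have hS : ∀ i ∈ S, i ≤ N := by
    intro i hi; simp only [hSdef, Set.mem_union, Set.mem_Icc] at hi; omega
  have hT : ∀ i ∈ T, i ≤ N := by
    intro i hi; simp only [hTdef, Set.mem_union, Set.mem_singleton_iff] at hi; omega
  choose c hc1 hc2 using fun a => aux_coeff_eq hx hS hT k a hce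
  have hsup : ∀ a (q : Fin (N + 1) × Fin d), q.1 ≠ k →
      (C *ᵥ (Pi.single (k, a) 1 - c a)) q = 0 := by
    intro a q hq
    refine hc2 a q ?_
    have h1 : (q.1 : ℕ) ≠ k := fun h => hq (Fin.ext h)
    have h2 := q.1.2
    simp only [idx, hSdef, Set.mem_ofPred_eq, Set.mem_union, Set.mem_Icc]
    omega
  let W : Mat d := fun b a => (C *ᵥ (Pi.single (k, a) 1 - c a)) (k, b)
  let P : Fin (N + 1) → Mat d := fun i a b => C⁻¹ (i, a) (k, b)
  have hPW : ∀ i a b, (P i * W) a b =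
      ((Pi.single (k, b) 1 : Fin (N + 1) × Fin d → ℝ) - c b) (i, a) := by
    intro i a b
    have h := congrFun (aux_inv_apply hx.2.2 (Pi.single (k, b) 1 - c b)) (i, a)
    rw [← h, mulVec, dotProduct, Fintype.sum_prod_type, Finset.sum_eq_single k]
    · rfl
    · intro q _ hq
      exact Finset.sum_eq_zero fun b' _ => by rw [hsup b (q, b') hq, mul_zero]
    · simp
  have hkk : P k * W = 1 := by
    ext a b
    rw [hPW, Pi.sub_apply, hc1 b (k, a)]
    · simp [Pi.single_apply, Matrix.one_apply]
    · simp only [idx, hTdef, Set.mem_ofPred_eq, Set.mem_union, Set.mem_singleton_iff]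
      omega
  have hWk : W * P k = 1 := mul_eq_one_comm.1 hkk
  have hsk : P s * W = 0 := by
    ext a b
    rw [hPW, Pi.sub_apply, hc1 b (s, a)]
    · have : s ≠ k := by rintro rfl; rcases hf with h | h <;> omega
      simp [this]
    · simp only [idx, hTdef, Set.mem_ofPred_eq, Set.mem_union, Set.mem_singleton_iff]
      rcases hf with h | h <;> omega
  have h0 : P s = 0 := by
    calc P s = P s * (W * P k) := by rw [hWk, mul_one]
      _ = 0 := by rw [← mul_assoc, hsk, zero_mul]
  intro a b
  exact congrFun (congrFun h0 a) b

theorem aux_backward {N d : ℕ} {μ : Measure Ω} [IsProbabilityMeasure μ]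
    {x : ℕ → Ω → Fin d → ℝ} {C : Matrix (Fin (N + 1) × Fin d) (Fin (N + 1) × Fin d) ℝ}
    (hx : ZMNG N d μ x C) (hP : CyclicBlockTriDiag C⁻¹) : IsReciprocal μ x N := by
  intro j k l hjk hkl hlN
  set S : Set ℕ := Set.Icc 0 j ∪ Set.Icc l N with hSdef
  set T : Set ℕ := {j} ∪ {l} with hTdef
  have hS : ∀ i ∈ S, i ≤ N := by
    intro i hi; simp only [hSdef, Set.mem_union, Set.mem_Icc] at hi; omega
  have hTS : T ⊆ S := by
    intro i hi
    simp only [hSdef, hTdef, Set.mem_union, Set.mem_Icc, Set.mem_singleton_iff] at hi ⊢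
    omega
  have hkS : k ∉ S := by
    simp only [hSdef, Set.mem_union, Set.mem_Icc]; omega
  let k' : Fin (N + 1) := ⟨k, by omega⟩
  choose c hc1 hc2 using fun a =>
    aux_regress hx.2.2 (idx N d S) (Pi.single (k', a) 1)
  refine aux_condEq hx hS hTS k' c ?_ hc2
  intro a p hp
  by_cases hpS : p ∈ idx N d S
  swap
  · exact hc1 a p hpS
  have h := congrFun (aux_inv_apply hx.2.2 (Pi.single (k', a) 1 - c a)) p
  have hne : p ≠ (k', a) := by
    rintro rfl
    exact hkS hpS
  rw [Pi.sub_apply, Pi.single_eq_of_ne hne, zero_sub] at h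
  have hz : (C⁻¹ *ᵥ (C *ᵥ (Pi.single (k', a) 1 - c a))) p = 0 := by
    rw [mulVec, dotProduct]
    refine Finset.sum_eq_zero fun q _ => ?_
    by_cases hq : q ∈ idx N d S
    · rw [hc2 a q hq, mul_zero]
    · have hz : C⁻¹ (p.1, p.2) (q.1, q.2) = 0 := by
        have hp1 := p.1.2
        have hq1 := q.1.2
        simp only [idx, hSdef, hTdef, Set.mem_ofPred_eq, Set.mem_union, Set.mem_Icc,
          Set.mem_singleton_iff] at hp hpS hq
        refine hP p.1 q.1 ?_ ?_ ?_ p.2 q.2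
        · unfold Far; omega
        · omega
        · omega
      rw [show C⁻¹ p q = 0 from hz, zero_mul]
  linarith

end Helpers

/-- A zero-mean nonsingular Gaussian sequence `[x_k]`, `k ∈ [0,N]`,
with covariance matrix `C` is reciprocal iff `C⁻¹` is cyclic block tri-diagonal. -/
theorem stmt2 {N d : ℕ} (hN : 3 ≤ N) (hd : 1 ≤ d)
    (μ : Measure Ω) [IsProbabilityMeasure μ] (x : ℕ → Ω → Fin d → ℝ)
    (C : Matrix (Fin (N + 1) × Fin d) (Fin (N + 1) × Fin d) ℝ)
    (hx : ZMNG N d μ x C) :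
    IsReciprocal μ x N ↔ CyclicBlockTriDiag C⁻¹ := by
  refine ⟨fun hr i j hf h1 h2 => ?_, aux_backward hx⟩
  by_cases hj : (j : ℕ) ≠ 0 ∧ (j : ℕ) ≠ N
  · exact aux_forward_block hx hr i j hj.1 hj.2 hf
  · have hi := i.2
    have hj' := j.2
    have hf' : Far j i := hf.symm
    have h := aux_forward_block hx hr j i (by unfold Far at hf; omega)
      (by unfold Far at hf; omega) hf'
    intro a b
    rw [aux_inv_symm hx.2.2]
    exact h b a

end CMSeqPaper
end

section
/- Let [x_k], k ∈ [0,N], be a zero-mean nonsingular Gaussian sequence with covariance C, let A = C⁻¹, and let k_1 ∈ [1,N−1]. Partition A into blocks A11 = A_[1:k_1,1:k_1] (the first k_1 block rows and columns), A22 = A_[k_1+1:N+1,k_1+1:N+1], and A12 = A_[1:k_1,k_1+1:N+1]. Then [x_k] is [k_1,N]-CM_c for c ∈ {k_1,N} if and only if the Schur complement Δ_{A11} = A22 − A12' A11⁻¹ A12 has the CM_c form as a matrix of (N−k_1+1)×(N−k_1+1) blocks of size d×d. -/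
open MeasureTheory ProbabilityTheory Matrix
open scoped NNReal

namespace CMSeqPaper

variable {Ω : Type*} [MeasurableSpace Ω]

/-- Product of the Schur complement of the precision matrix with the covariance. -/
theorem schur_mul {ι α β : Type*} [Fintype ι] [DecidableEq ι] [Fintype α] [DecidableEq α]
    [Fintype β] [DecidableEq β] (C : Matrix ι ι ℝ) (hC : C.PosDef) (f1 : α → ι) (f2 : β → ι)
    (hf : Function.Bijective (Sum.elim f1 f2)) :
    (C⁻¹.submatrix f2 f2 - (C⁻¹.submatrix f1 f2)ᵀ * (C⁻¹.submatrix f1 f1)⁻¹ *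
      C⁻¹.submatrix f1 f2) * C.submatrix f2 f2 = 1 := by
  have hA : C⁻¹.PosDef := hC.inv
  have hf1 : Function.Injective f1 := fun a b h => by
    have := @hf.1 (Sum.inl a) (Sum.inl b) (by simpa using h)
    simpa using this
  have hf2 : Function.Injective f2 := fun a b h => by
    have := @hf.1 (Sum.inr a) (Sum.inr b) (by simpa using h)
    simpa using this
  have hdis : ∀ a b, f1 a ≠ f2 b := fun a b h => by
    have := @hf.1 (Sum.inl a) (Sum.inr b) (by simpa using h)
    simp at this
  have h11 : (C⁻¹.submatrix f1 f1).PosDef := hA.submatrix hf1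
  have hAC : C⁻¹ * C = 1 := Matrix.nonsing_inv_mul _ ((Matrix.isUnit_iff_isUnit_det _).1 hC.isUnit)
  have hsum : ∀ F : ι → ℝ, ∑ i, F i = ∑ a, F (f1 a) + ∑ b, F (f2 b) := by
    intro F
    rw [← (Equiv.ofBijective _ hf).sum_comp F, Fintype.sum_sum_type]
    rfl
  have hent : ∀ i j, ∑ a, C⁻¹ i (f1 a) * C (f1 a) j + ∑ b, C⁻¹ i (f2 b) * C (f2 b) j
      = (1 : Matrix ι ι ℝ) i j := by
    intro i j
    rw [← hAC, Matrix.mul_apply, hsum]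
  have e1 : C⁻¹.submatrix f1 f1 * C.submatrix f1 f2 + C⁻¹.submatrix f1 f2 * C.submatrix f2 f2
      = 0 := by
    ext a b
    have := hent (f1 a) (f2 b)
    rw [Matrix.one_apply_ne (hdis a b)] at this
    simpa [Matrix.mul_apply] using this
  have e2 : C⁻¹.submatrix f2 f1 * C.submatrix f1 f2 + C⁻¹.submatrix f2 f2 * C.submatrix f2 f2
      = 1 := by
    ext a b
    have := hent (f2 a) (f2 b)
    simp only [Matrix.one_apply, hf2.eq_iff] at this
    simpa [Matrix.mul_apply, Matrix.one_apply] using this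
  have hT : (C⁻¹.submatrix f1 f2)ᵀ = C⁻¹.submatrix f2 f1 := by
    ext a b
    have := congrFun (congrFun hA.1 (f2 a)) (f1 b)
    simpa using this
  have hi : (C⁻¹.submatrix f1 f1)⁻¹ * C⁻¹.submatrix f1 f1 = 1 :=
    Matrix.nonsing_inv_mul _ ((Matrix.isUnit_iff_isUnit_det _).1 h11.isUnit)
  rw [hT, Matrix.sub_mul, Matrix.mul_assoc, Matrix.mul_assoc, eq_neg_of_add_eq_zero_right e1,
    Matrix.mul_neg, ← Matrix.mul_assoc _ (C⁻¹.submatrix f1 f1), hi, Matrix.one_mul, ← e2,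
    Matrix.mul_neg, sub_neg_eq_add, add_comm]

/-- Residual of a vector on the coordinates in `T`. -/
theorem exists_resid {β : Type*} [Fintype β] [DecidableEq β] (D : Matrix β β ℝ) (hD : D.PosDef)
    (T : Set β) (l : β → ℝ) :
    ∃ g : β → ℝ, (∀ i, i ∉ T → g i = 0) ∧ ∀ i ∈ T, (D *ᵥ (l - g)) i = 0 := by
  classical
  let M : Matrix T T ℝ := D.submatrix (fun i : T => (i : β)) (fun i : T => (i : β))
  have hM : M.PosDef := hD.submatrix Subtype.val_injective
  have hi : M * M⁻¹ = 1 :=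
    Matrix.mul_nonsing_inv _ ((Matrix.isUnit_iff_isUnit_det _).1 hM.isUnit)
  let w : T → ℝ := M⁻¹ *ᵥ (fun i => (D *ᵥ l) i)
  refine ⟨fun i => if h : i ∈ T then w ⟨i, h⟩ else 0, fun i h => by simp [h], ?_⟩
  intro i hiT
  have h1 : (M *ᵥ w) ⟨i, hiT⟩ = (D *ᵥ l) i := by
    simp [w, Matrix.mulVec_mulVec, hi]
  rw [Matrix.mulVec_sub, Pi.sub_apply, ← h1, sub_eq_zero]
  simp only [Matrix.mulVec, dotProduct, M, Matrix.submatrix_apply]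
  rw [← Fintype.sum_subtype_add_sum_subtype (fun i => i ∈ T) (fun j => D i j * (if h : j ∈ T then w ⟨j, h⟩ else 0))]
  have : ∑ x : {j // j ∉ T}, D i x * (if h : (x : β) ∈ T then w ⟨x, h⟩ else 0) = 0 := by
    apply Finset.sum_eq_zero
    intro x _
    simp [x.2]
  rw [this, add_zero]
  apply Finset.sum_congr rfl
  intro x _
  simp [x.2]

/-- Linear-algebra core: zero blocks of the precision matrix against sparse regression. -/
theorem core {β : Type*} [Fintype β] [DecidableEq β] (P D : Matrix β β ℝ) (hD : D.PosDef)
    (hPD : P * D = 1) (U V T : Set β) (hUV : Disjoint U V) (hUT : Disjoint U T)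
    (hVT : Disjoint V T) (hcov : ∀ i, i ∈ U ∨ i ∈ V ∨ i ∈ T) :
    (∀ k ∈ U, ∃ g : β → ℝ, (∀ i, i ∉ T → g i = 0) ∧
      ∀ i, i ∉ U → (D *ᵥ (Pi.single k 1 - g)) i = 0) ↔ ∀ u ∈ U, ∀ v ∈ V, P v u = 0 := by
  classical
  have hDP : D * P = 1 := by rwa [_root_.mul_eq_one_comm]
  have hPeq : P = D⁻¹ := (Matrix.inv_eq_left_inv hPD).symm
  have hP : P.PosDef := hPeq ▸ hD.inv
  have sumU : ∀ m : β → ℝ, (∀ i, i ∉ U → m i = 0) → ∀ F : β → ℝ,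
      ∑ i, F i * m i = ∑ i : U, F i * m i := by
    intro m hm F
    rw [← Fintype.sum_subtype_add_sum_subtype (fun i => i ∈ U) (fun j => F j * m j)]
    have : ∑ x : {j // j ∉ U}, F x * m x = 0 := by
      apply Finset.sum_eq_zero
      intro x _
      simp [hm _ x.2]
    rw [this, add_zero]
  constructor
  · intro h
    choose g hgT hg using h
    let m : U → β → ℝ := fun k => D *ᵥ (Pi.single k.1 1 - g k.1 k.2)
    have hm : ∀ k i, i ∉ U → m k i = 0 := fun k i hi => hg k.1 k.2 i hi
    have hPm : ∀ k, P *ᵥ m k = Pi.single k.1 1 - g k.1 k.2 := fun k => by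
      simp [m, Matrix.mulVec_mulVec, hPD]
    let M : Matrix U U ℝ := fun u k => m k u
    let PU : Matrix U U ℝ := fun u k => P u k
    have h1 : PU * M = 1 := by
      ext u k
      have := congrFun (hPm k) u
      rw [Matrix.mulVec, dotProduct, sumU _ (hm k)] at this
      rw [Matrix.mul_apply]
      simp only [PU, M]
      rw [this]
      have : (u : β) ∉ T := fun h => Set.disjoint_left.1 hUT u.2 h
      simp [hgT k.1 k.2 u this, Matrix.one_apply, Pi.single_apply, Subtype.ext_iff]
    have h2 : M * PU = 1 := by rwa [_root_.mul_eq_one_comm]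
    intro u hu v hv
    have h3 : (fun k : U => P v k) ᵥ* M = 0 := by
      ext k
      have := congrFun (hPm k) v
      rw [Matrix.mulVec, dotProduct, sumU _ (hm k)] at this
      simp only [Matrix.vecMul, dotProduct, M]
      rw [this]
      have hT : v ∉ T := fun h => Set.disjoint_left.1 hVT hv h
      have hk : v ≠ k := fun h => Set.disjoint_left.1 hUV k.2 (h ▸ hv)
      simp [hgT k.1 k.2 v hT, hk]
    have h4 : (fun k : U => P v k) = 0 := by
      have : ((fun k : U => P v k) ᵥ* M) ᵥ* PU = 0 := by rw [h3, Matrix.zero_vecMul]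
      rwa [Matrix.vecMul_vecMul, h2, Matrix.vecMul_one] at this
    exact congrFun h4 ⟨u, hu⟩
  · intro h k hk
    obtain ⟨g, hg1, hg2⟩ := exists_resid P hP U (P⁻¹ *ᵥ Pi.single k 1)
    have hPP : P * P⁻¹ = 1 :=
      Matrix.mul_nonsing_inv _ ((Matrix.isUnit_iff_isUnit_det _).1 hP.isUnit)
    rw [Matrix.mulVec_sub, Matrix.mulVec_mulVec, hPP, Matrix.one_mulVec] at hg2
    refine ⟨Pi.single k 1 - P *ᵥ g, ?_, ?_⟩
    · intro i hi
      by_cases hU : i ∈ U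
      · exact hg2 i hU
      · have hV : i ∈ V := by have := hcov i; tauto
        have hik : i ≠ k := fun h => hU (h ▸ hk)
        have : (P *ᵥ g) i = 0 := by
          rw [Matrix.mulVec, dotProduct, sumU g hg1]
          exact Finset.sum_eq_zero fun x _ => by rw [h x x.2 i hV, zero_mul]
        simp [this, hik]
    · intro i hi
      rw [sub_sub_cancel, Matrix.mulVec_mulVec, hDP, Matrix.one_mulVec]
      exact hg1 i hi

section Prob

variable {β : Type*} [Fintype β] [DecidableEq β] {μ : Measure Ω} [IsProbabilityMeasure μ]
  {Y : Ω → β → ℝ} {D : Matrix β β ℝ}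

theorem gl_of (hY : Measurable Y) (h : IsZeroMeanGaussian μ Y D) : HasGaussianLaw Y μ := by
  refine ⟨isGaussian_of_map_eq_gaussianReal fun L => ?_⟩
  refine ⟨0, ((fun i => L (Pi.single i 1)) ⬝ᵥ D *ᵥ (fun i => L (Pi.single i 1))).toNNReal, ?_⟩
  · rw [Measure.map_map (by fun_prop) hY, ← h (fun i => L (Pi.single i 1))]
    congr 1
    ext ω
    have : Y ω = ∑ i, Y ω i • Pi.single (M := fun _ => ℝ) i 1 := by
      rw [← pi_eq_sum_univ' (Y ω)]
    simp only [Function.comp_apply]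
    conv_lhs => rw [this]
    simp [mul_comm]

theorem meas_lin (hY : Measurable Y) (l : β → ℝ) : Measurable (fun ω => l ⬝ᵥ Y ω) := by
  unfold dotProduct
  fun_prop

theorem memLp_lin (hY : Measurable Y) (h : IsZeroMeanGaussian μ Y D) (l : β → ℝ) :
    MemLp (fun ω => l ⬝ᵥ Y ω) 2 μ := by
  have h1 := h l
  have : MemLp (id ∘ fun ω => l ⬝ᵥ Y ω) 2 μ := by
    rw [← memLp_map_measure_iff (by fun_prop) (meas_lin hY l).aemeasurable]
    unfold dotProduct
    rw [h1]
    exact memLp_id_gaussianReal 2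
  exact this

theorem mean_lin (hY : Measurable Y) (h : IsZeroMeanGaussian μ Y D) (l : β → ℝ) :
    ∫ ω, l ⬝ᵥ Y ω ∂μ = 0 := by
  have h1 := h l
  have h2 := integral_map (μ := μ) (φ := fun ω => l ⬝ᵥ Y ω) (meas_lin hY l).aemeasurable
    (f := fun x : ℝ => x) (by fun_prop)
  rw [← h2]
  unfold dotProduct
  rw [h1, integral_id_gaussianReal]

theorem sq_lin (hY : Measurable Y) (hD : D.PosDef) (h : IsZeroMeanGaussian μ Y D) (l : β → ℝ) :
    ∫ ω, (l ⬝ᵥ Y ω) ^ 2 ∂μ = l ⬝ᵥ D *ᵥ l := by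
  have h1 := h l
  have hv : Var[fun ω => l ⬝ᵥ Y ω; μ] = l ⬝ᵥ D *ᵥ l := by
    have := variance_map (μ := μ) (X := (id : ℝ → ℝ)) (Y := fun ω => l ⬝ᵥ Y ω)
      (by fun_prop) (meas_lin hY l).aemeasurable
    rw [Function.id_comp] at this
    rw [← this]
    unfold dotProduct
    rw [h1, variance_id_gaussianReal, Real.coe_toNNReal]
    · rfl
    · simpa using hD.posSemidef.dotProduct_mulVec_nonneg l
  rw [← hv, variance_of_integral_eq_zero (meas_lin hY l).aemeasurable (mean_lin hY h l)]

theorem mul_lin (hY : Measurable Y) (hD : D.PosDef) (h : IsZeroMeanGaussian μ Y D)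
    (l m : β → ℝ) : ∫ ω, (l ⬝ᵥ Y ω) * (m ⬝ᵥ Y ω) ∂μ = l ⬝ᵥ D *ᵥ m := by
  have i1 := (memLp_lin hY h l).integrable_sq
  have i2 := (memLp_lin hY h m).integrable_sq
  have i3 : Integrable (fun ω => (l ⬝ᵥ Y ω) * (m ⬝ᵥ Y ω)) μ :=
    (memLp_lin hY h l).integrable_mul (memLp_lin hY h m)
  have hs := sq_lin hY hD h (l + m)
  have h1 : ∀ ω, ((l + m) ⬝ᵥ Y ω) ^ 2 =
      ((l ⬝ᵥ Y ω) ^ 2 + (m ⬝ᵥ Y ω) ^ 2) + 2 * ((l ⬝ᵥ Y ω) * (m ⬝ᵥ Y ω)) := by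
    intro ω
    rw [add_dotProduct]
    ring
  simp only [h1] at hs
  have i12 : Integrable (fun ω => (l ⬝ᵥ Y ω) ^ 2 + (m ⬝ᵥ Y ω) ^ 2) μ := i1.add i2
  rw [integral_add i12 (i3.const_mul 2), integral_add i1 i2, integral_const_mul,
    sq_lin hY hD h, sq_lin hY hD h, Matrix.mulVec_add, dotProduct_add, add_dotProduct,
    add_dotProduct] at hs
  have hsym : m ⬝ᵥ D *ᵥ l = l ⬝ᵥ D *ᵥ m := by
    have hT : Dᵀ = D := by simpa using hD.1.eq
    rw [dotProduct_mulVec, ← Matrix.mulVec_transpose, hT, dotProduct_comm]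
  linarith

theorem indep_lin (hY : Measurable Y) (hD : D.PosDef) (h : IsZeroMeanGaussian μ Y D)
    {κ : Type*} [Finite κ] (l : κ → β → ℝ) (S : Set β)
    (hl : ∀ a, ∀ i ∈ S, (D *ᵥ l a) i = 0) :
    IndepFun (fun ω a => l a ⬝ᵥ Y ω) (fun ω (i : S) => Y ω i) μ := by
  have := Fintype.ofFinite κ
  have := Fintype.ofFinite S
  have hg := gl_of hY h
  apply HasGaussianLaw.indepFun_of_covariance_eval (X := fun a ω => l a ⬝ᵥ Y ω)
    (Y := fun (i : S) ω => Y ω i)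
  · let L : (β → ℝ) →ₗ[ℝ] (κ → ℝ) × (S → ℝ) :=
      { toFun := fun y => (fun a => l a ⬝ᵥ y, fun i => y i)
        map_add' := by intro x y; ext <;> simp [dotProduct_add]
        map_smul' := by intro x y; ext <;> simp [dotProduct_smul] }
    exact hg.map_fun (LinearMap.toContinuousLinearMap L)
  · intro a i
    have e : (fun ω => Y ω i) = fun ω => Pi.single (M := fun _ => ℝ) i.1 1 ⬝ᵥ Y ω := by
      ext ω; simp
    rw [e, covariance_eq_sub (memLp_lin hY h _) (memLp_lin hY h _)]
    have h2 := mul_lin hY hD h (Pi.single i.1 1) (l a)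
    simp only [mul_comm (Pi.single (M := fun _ => ℝ) i.1 1 ⬝ᵥ Y _)] at h2
    rw [mean_lin hY h, zero_mul, sub_zero]
    simp only [Pi.mul_apply]
    rw [h2]
    simpa using hl a i i.2

/-- σ-algebra generated by the coordinates in `S`. -/
def sig (Y : Ω → β → ℝ) (S : Set β) : MeasurableSpace Ω :=
  MeasurableSpace.comap (fun ω (i : S) => Y ω i) inferInstance

theorem condExp_indep_s5 {E : Type*} [MeasurableSpace E]
    {κ : Type*} [Finite κ] {W : Ω → E} (hW : Measurable W) {R : Ω → κ → ℝ}
    (hR : Measurable R) (hi : IndepFun R W μ) (f : E × (κ → ℝ) → ℝ) (hf : StronglyMeasurable f)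
    (hint : Integrable (fun ω => f (W ω, R ω)) μ) :
    μ[fun ω => f (W ω, R ω) | MeasurableSpace.comap W inferInstance]
      =ᵐ[μ] fun ω => ∫ r, f (W ω, r) ∂(μ.map R) := by
  have := Fintype.ofFinite κ
  refine (condExp_prod_ae_eq_integral_condDistrib hW hR.aemeasurable hf hint).trans ?_
  have hp : IsProbabilityMeasure (μ.map R) := Measure.isProbabilityMeasure_map hR.aemeasurable
  have h1 : condDistrib R W μ =ᵐ[μ.map W] Kernel.const E (μ.map R) := by
    apply condDistrib_ae_eq_of_measure_eq_compProd W hR.aemeasurable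
    rw [Measure.compProd_const]
    exact (indepFun_iff_map_prod_eq_prod_map_map hW.aemeasurable hR.aemeasurable).1 hi.symm
  filter_upwards [ae_of_ae_map hW.aemeasurable h1] with ω hω
  rw [hω, Kernel.const_apply]

theorem cond_of_lin (hY : Measurable Y) (hD : D.PosDef) (h : IsZeroMeanGaussian μ Y D)
    {κ : Type*} [Finite κ] (q : κ → β) (S T : Set β) (hTS : T ⊆ S)
    (hg : ∀ a, ∃ g : β → ℝ, (∀ i, i ∉ T → g i = 0) ∧
      ∀ i ∈ S, (D *ᵥ (Pi.single (q a) 1 - g)) i = 0)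
    (A : Set (κ → ℝ)) (hA : MeasurableSet A) :
    μ[A.indicator (fun _ => (1 : ℝ)) ∘ (fun ω a => Y ω (q a)) | sig Y S]
      =ᵐ[μ] μ[A.indicator (fun _ => (1 : ℝ)) ∘ (fun ω a => Y ω (q a)) | sig Y T] := by
  classical
  have := Fintype.ofFinite κ
  choose g hgT hg using hg
  let R : Ω → κ → ℝ := fun ω a => (Pi.single (q a) 1 - g a) ⬝ᵥ Y ω
  have hR : Measurable R := measurable_pi_lambda _ fun a => meas_lin hY _
  have key : ∀ S' : Set β, T ⊆ S' → S' ⊆ S →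
      μ[A.indicator (fun _ => (1 : ℝ)) ∘ (fun ω a => Y ω (q a)) | sig Y S'] =ᵐ[μ]
        fun ω => ∫ r, A.indicator (fun _ => (1 : ℝ)) (fun a => g a ⬝ᵥ Y ω + r a) ∂(μ.map R) := by
    intro S' hTS' hS'
    have hS'f := Fintype.ofFinite S'
    have hi : IndepFun R (fun ω (i : S') => Y ω i) μ :=
      indep_lin hY hD h _ S' fun a i hi => hg a i (hS' hi)
    have hW : Measurable (fun ω (i : S') => Y ω i) := by fun_prop
    let f : (S' → ℝ) × (κ → ℝ) → ℝ := fun p =>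
      A.indicator (fun _ => (1 : ℝ)) (fun a => ∑ i : S', g a i * p.1 i + p.2 a)
    have hf : Measurable f := by
      refine (measurable_const.indicator hA).comp ?_
      fun_prop
    have hsum : ∀ a ω, ∑ i : S', g a i * Y ω i = g a ⬝ᵥ Y ω := by
      intro a ω
      unfold dotProduct
      rw [← Fintype.sum_subtype_add_sum_subtype (fun i => i ∈ S') (fun j => g a j * Y ω j)]
      have : ∑ x : {j // j ∉ S'}, g a x * Y ω x = 0 := by
        apply Finset.sum_eq_zero
        intro x _
        rw [hgT a x (fun hx => x.2 (hTS' hx)), zero_mul]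
      rw [this, add_zero]
      exact Finset.sum_congr (by ext; simp) fun _ _ => rfl
    have he : (A.indicator (fun _ => (1 : ℝ)) ∘ (fun ω a => Y ω (q a))) =
        fun ω => f ((fun (i : S') => Y ω i), R ω) := by
      ext ω
      simp only [Function.comp_apply, f, hsum]
      congr 1
      ext a
      simp [R, sub_dotProduct]
    have hint : Integrable (fun ω => f ((fun (i : S') => Y ω i), R ω)) μ := by
      refine Integrable.of_bound (C := 1) (hf.comp (hW.prodMk hR)).aestronglyMeasurable ?_
      refine Filter.Eventually.of_forall fun ω => ?_
      simp only [f, Set.indicator]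
      split_ifs <;> simp
    rw [he]
    refine (condExp_indep_s5 hW hR hi f hf.stronglyMeasurable hint).trans ?_
    refine Filter.Eventually.of_forall fun ω => ?_
    simp only [f, hsum]
  exact (key S hTS subset_rfl).trans (key T subset_rfl hTS).symm

theorem lin_of_cond (hY : Measurable Y) (hD : D.PosDef) (h : IsZeroMeanGaussian μ Y D)
    {κ : Type*} [Finite κ] (q : κ → β) (S T : Set β) (hTS : T ⊆ S)
    (hA : ∀ A : Set (κ → ℝ), MeasurableSet A →
    μ[A.indicator (fun _ => (1 : ℝ)) ∘ (fun ω a => Y ω (q a)) | sig Y S]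
      =ᵐ[μ] μ[A.indicator (fun _ => (1 : ℝ)) ∘ (fun ω a => Y ω (q a)) | sig Y T]) (a : κ) :
    ∃ g : β → ℝ, (∀ i, i ∉ T → g i = 0) ∧
      ∀ i ∈ S, (D *ᵥ (Pi.single (q a) 1 - g)) i = 0 := by
  classical
  have := Fintype.ofFinite κ
  have hST := Fintype.ofFinite T
  let Z : Ω → κ → ℝ := fun ω a => Y ω (q a)
  have hZ : Measurable Z := by fun_prop
  have hmS : ∀ S', sig Y S' ≤ ‹MeasurableSpace Ω› := fun S' =>
    Measurable.comap_le (by fun_prop)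
  have hsym : ∀ l m, m ⬝ᵥ D *ᵥ l = l ⬝ᵥ D *ᵥ m := by
    intro l m
    have hT : Dᵀ = D := by simpa using hD.1.eq
    rw [dotProduct_mulVec, ← Matrix.mulVec_transpose, hT, dotProduct_comm]
  -- residuals
  have main : ∀ i ∈ S, ∀ g : β → ℝ, (∀ i, i ∉ T → g i = 0) →
      (∀ j ∈ T, (D *ᵥ (Pi.single i 1 - g)) j = 0) →
      (D *ᵥ (Pi.single i 1 - g)) (q a) = 0 := by
    intro i hiS g hgT hg
    set r := Pi.single i 1 - g with hr
    have hmeas := meas_lin hY r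
    have hL2 := memLp_lin hY h r
    have hint : Integrable (fun ω => r ⬝ᵥ Y ω) μ := hL2.integrable (by norm_num)
    have hsm : StronglyMeasurable[sig Y S] (fun ω => r ⬝ᵥ Y ω) := by
      apply Measurable.stronglyMeasurable
      have hco : ∀ j ∈ S, Measurable[sig Y S] (fun ω => Y ω j) := fun j hj =>
        (measurable_pi_apply (⟨j, hj⟩ : S)).comp
          (comap_measurable (fun ω (i : S) => Y ω i))
      unfold dotProduct
      refine Finset.measurable_sum _ fun j _ => ?_
      by_cases hj : j ∈ S
      · exact (hco j hj).const_mul _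
      · have h1 : j ≠ i := fun e => hj (e ▸ hiS)
        have h2 : g j = 0 := hgT j fun e => hj (hTS e)
        have : r j = 0 := by simp [hr, h1, h2]
        simp only [this, zero_mul]
        exact measurable_const
    have hindep : IndepFun (fun ω (_ : Unit) => r ⬝ᵥ Y ω) (fun ω (i : T) => Y ω i) μ :=
      indep_lin hY hD h (fun _ => r) T fun _ => hg
    have hzero : ∀ A : Set (κ → ℝ), MeasurableSet A →
        ∫ ω in Z ⁻¹' A, r ⬝ᵥ Y ω ∂μ = 0 := by
      intro A hAm
      set F : Ω → ℝ := A.indicator (fun _ => (1 : ℝ)) ∘ Z with hF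
      have hFm : Measurable F := (measurable_const.indicator hAm).comp hZ
      have hFb : ∀ ω, ‖F ω‖ ≤ 1 := fun ω => by
        simp only [hF, Function.comp_apply, Set.indicator]; split_ifs <;> simp
      have hFi : Integrable F μ :=
        Integrable.of_bound hFm.aestronglyMeasurable 1 (Filter.Eventually.of_forall hFb)
      have hFr : Integrable (F * fun ω => r ⬝ᵥ Y ω) μ :=
        hint.bdd_mul hFm.aestronglyMeasurable (Filter.Eventually.of_forall hFb)
      have e1 : ∫ ω in Z ⁻¹' A, r ⬝ᵥ Y ω ∂μ = ∫ ω, (F * fun ω => r ⬝ᵥ Y ω) ω ∂μ := by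
        rw [← integral_indicator (hZ hAm)]
        congr 1
        ext ω
        by_cases hω : Z ω ∈ A <;> simp [hF, Set.indicator, hω]
      have e2 := condExp_mul_of_stronglyMeasurable_right hsm hFr hFi
      rw [e1, ← integral_condExp (hmS S), integral_congr_ae e2]
      have e3 : (μ[F | sig Y S] * fun ω => r ⬝ᵥ Y ω) =ᵐ[μ]
          (μ[F | sig Y T] * fun ω => r ⬝ᵥ Y ω) := (hA A hAm).mul (Filter.EventuallyEq.refl _ _)
      rw [integral_congr_ae e3]
      have hi2 : IndepFun (μ[F | sig Y T]) (fun ω => r ⬝ᵥ Y ω) μ := by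
        have hm : Measurable[sig Y T] (μ[F | sig Y T]) := stronglyMeasurable_condExp.measurable
        obtain ⟨φ, hφ, hφe⟩ := hm.exists_eq_measurable_comp
        rw [hφe]
        exact (hindep.comp (measurable_pi_apply ()) hφ).symm
      rw [hi2.integral_mul_eq_mul_integral
        (stronglyMeasurable_condExp.mono (hmS T)).aestronglyMeasurable
        hmeas.aestronglyMeasurable, mean_lin hY h, mul_zero]
    have hmZ : MeasurableSpace.comap Z inferInstance ≤ ‹MeasurableSpace Ω› := hZ.comap_le
    have hc0 : (fun _ => (0 : ℝ)) =ᵐ[μ]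
        μ[fun ω => r ⬝ᵥ Y ω | MeasurableSpace.comap Z inferInstance] := by
      refine ae_eq_condExp_of_forall_setIntegral_eq hmZ hint (fun s _ _ => ?_) ?_ ?_
      · exact (integrable_zero _ _ _).integrableOn
      · rintro s ⟨A, hAm, rfl⟩ _
        simp [hzero A hAm]
      · exact stronglyMeasurable_const.aestronglyMeasurable
    have hZs : StronglyMeasurable[MeasurableSpace.comap Z inferInstance]
        (fun ω => Pi.single (M := fun _ => ℝ) (q a) 1 ⬝ᵥ Y ω) := by
      apply Measurable.stronglyMeasurable
      have : (fun ω => Pi.single (M := fun _ => ℝ) (q a) 1 ⬝ᵥ Y ω) = fun ω => Z ω a := by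
        ext ω; simp [Z]
      rw [this]
      exact (measurable_pi_apply a).comp (comap_measurable Z)
    have hpr : Integrable ((fun ω => Pi.single (M := fun _ => ℝ) (q a) 1 ⬝ᵥ Y ω) *
        fun ω => r ⬝ᵥ Y ω) μ := (memLp_lin hY h _).integrable_mul hL2
    have e4 := condExp_mul_of_stronglyMeasurable_left hZs hpr hint
    have e5 := mul_lin hY hD h (Pi.single (q a) 1) r
    have e6 : ∫ ω, (Pi.single (M := fun _ => ℝ) (q a) 1 ⬝ᵥ Y ω) * (r ⬝ᵥ Y ω) ∂μ = 0 := by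
      change ∫ ω, ((fun ω => Pi.single (M := fun _ => ℝ) (q a) 1 ⬝ᵥ Y ω) *
        fun ω => r ⬝ᵥ Y ω) ω ∂μ = 0
      rw [← integral_condExp hmZ, integral_congr_ae e4]
      rw [integral_congr_ae (g := fun _ => (0 : ℝ)), integral_zero]
      filter_upwards [hc0] with ω hω
      rw [Pi.mul_apply, ← hω, mul_zero]
    rw [e6] at e5
    simpa using e5.symm
  obtain ⟨g, hgT, hg⟩ := exists_resid D hD T (Pi.single (q a) 1)
  refine ⟨g, hgT, fun i hi => ?_⟩
  obtain ⟨g', hgT', hg'⟩ := exists_resid D hD T (Pi.single i 1)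
  have h1 := main i hi g' hgT' hg'
  have orth : ∀ g1 l : β → ℝ, (∀ i, i ∉ T → g1 i = 0) → (∀ i ∈ T, (D *ᵥ l) i = 0) →
      g1 ⬝ᵥ D *ᵥ l = 0 := by
    intro g1 l h1 h2
    refine Finset.sum_eq_zero fun j _ => ?_
    by_cases hj : j ∈ T
    · rw [h2 j hj, mul_zero]
    · rw [h1 j hj, zero_mul]
  have o1 := orth g' _ hgT' hg
  have o2 := orth g _ hgT hg'
  have h2 : Pi.single (q a) 1 ⬝ᵥ D *ᵥ (Pi.single i 1 - g') = 0 := by simpa using h1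
  have h3 := hsym (Pi.single i 1 - g') (Pi.single (q a) 1 - g)
  rw [sub_dotProduct, h2, o2, sub_dotProduct, o1] at h3
  have h4 : Pi.single i 1 ⬝ᵥ D *ᵥ (Pi.single (q a) 1 - g) = 0 := by linarith
  simpa using h4

end Prob


theorem gauss_sub {ι β : Type*} [Fintype ι] [DecidableEq ι] [Fintype β] {μ : Measure Ω}
    {X : Ω → ι → ℝ} {C : Matrix ι ι ℝ} (h : IsZeroMeanGaussian μ X C) (f : β → ι) :
    IsZeroMeanGaussian μ (fun ω p => X ω (f p)) (C.submatrix f f) := by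
  intro l
  let m : ι → ℝ := fun i => ∑ p, if f p = i then l p else 0
  have hm : ∀ F : ι → ℝ, ∑ i, m i * F i = ∑ p, l p * F (f p) := by
    intro F
    simp only [m, Finset.sum_mul]
    rw [Finset.sum_comm]
    simp
  have h1 := h m
  simp only [hm] at h1
  rw [h1]
  congr 2
  simp only [dotProduct, Matrix.mulVec, Matrix.submatrix_apply]
  rw [hm]
  refine Finset.sum_congr rfl fun p _ => ?_
  congr 1
  simp only [mul_comm (C _ _)]
  rw [hm]

theorem sigmaOf_eq_s5 {d n k₁ : ℕ} (x : ℕ → Ω → Fin d → ℝ) (S : Set ℕ)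
    (hS : ∀ i ∈ S, k₁ ≤ i ∧ i < k₁ + n) :
    sigmaOf x S = sig (fun ω (p : Fin n × Fin d) => x (k₁ + p.1) ω p.2)
      {p | k₁ + (p.1 : ℕ) ∈ S} := by
  apply le_antisymm
  · refine iSup₂_le fun i hi => ?_
    rw [← measurable_iff_comap_le]
    refine @measurable_pi_lambda _ _ _ (_) _ _ fun a => ?_
    obtain ⟨h1, h2⟩ := hS i hi
    obtain ⟨t, rfl⟩ := Nat.exists_eq_add_of_le h1
    exact (measurable_pi_apply (⟨(⟨t, by omega⟩, a), hi⟩ :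
      {p : Fin n × Fin d | k₁ + (p.1 : ℕ) ∈ S})).comp
      (comap_measurable (fun ω (p : {p : Fin n × Fin d | k₁ + (p.1 : ℕ) ∈ S}) =>
        x (k₁ + p.1.1) ω p.1.2))
  · unfold sig
    rw [← measurable_iff_comap_le]
    refine @measurable_pi_lambda _ _ _ (_) _ _ fun p => ?_
    have h1 : MeasurableSpace.comap (x (k₁ + p.1.1)) inferInstance ≤ sigmaOf x S :=
      le_iSup₂ (f := fun i (_ : i ∈ S) => MeasurableSpace.comap (x i) inferInstance)
        (k₁ + (p.1.1 : ℕ)) p.2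
    exact ((measurable_pi_apply p.1.2).comp (comap_measurable (x (k₁ + p.1.1)))).mono h1 le_rfl

theorem isCM_iff {n d k₁ N c : ℕ} (hn : N = k₁ + n) (hc : k₁ ≤ c ∧ c ≤ N)
    (μ : Measure Ω) [IsProbabilityMeasure μ] (x : ℕ → Ω → Fin d → ℝ)
    (D P : Matrix (Fin (n + 1) × Fin d) (Fin (n + 1) × Fin d) ℝ) (hD : D.PosDef)
    (hPD : P * D = 1) (hY : Measurable fun ω (p : Fin (n + 1) × Fin d) => x (k₁ + p.1) ω p.2)
    (hG : IsZeroMeanGaussian μ (fun ω (p : Fin (n + 1) × Fin d) => x (k₁ + p.1) ω p.2) D) :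
    IsCM μ x k₁ N c ↔ ∀ i j : Fin (n + 1), Far i j → k₁ + (i : ℕ) ≠ c → k₁ + (j : ℕ) ≠ c →
      BlockZero P i j := by
  have hPeq : P = D⁻¹ := (Matrix.inv_eq_left_inv hPD).symm
  have hP : P.PosDef := hPeq ▸ hD.inv
  have hPs : ∀ i j, P i j = P j i := fun i j => by
    have := congrFun (congrFun hP.1 j) i
    simpa using this
  let β := Fin (n + 1) × Fin d
  let U : ℕ → Set β := fun j => {p | j < (p.1 : ℕ) ∧ k₁ + (p.1 : ℕ) ≠ c}
  let V : ℕ → Set β := fun j => {p | (p.1 : ℕ) < j ∧ k₁ + (p.1 : ℕ) ≠ c}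
  let T : ℕ → Set β := fun j => {p | k₁ + (p.1 : ℕ) ∈ ({k₁ + j} ∪ {c} : Set ℕ)}
  let S : ℕ → Set β := fun j => {p | k₁ + (p.1 : ℕ) ∈ (Set.Icc k₁ (k₁ + j) ∪ {c} : Set ℕ)}
  have hSU : ∀ j p, p ∈ S j ↔ p ∉ U j := by
    intro j p
    simp only [S, U, Set.mem_union, Set.mem_Icc, Set.mem_singleton_iff, Set.mem_ofPred_eq]
    omega
  have hTS : ∀ j, T j ⊆ S j := by
    intro j p
    simp only [S, T, Set.mem_union, Set.mem_Icc, Set.mem_singleton_iff, Set.mem_ofPred_eq]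
    omega
  have hcore : ∀ j, (∀ k ∈ U j, ∃ g : β → ℝ, (∀ i, i ∉ T j → g i = 0) ∧
      ∀ i, i ∉ U j → (D *ᵥ (Pi.single k 1 - g)) i = 0) ↔
      ∀ u ∈ U j, ∀ v ∈ V j, P v u = 0 := by
    intro j
    refine core P D hD hPD (U j) (V j) (T j) ?_ ?_ ?_ ?_
    · refine Set.disjoint_left.2 fun p => ?_
      simp only [U, V, Set.mem_ofPred_eq]
      omega
    · refine Set.disjoint_left.2 fun p => ?_
      simp only [U, T, Set.mem_union, Set.mem_singleton_iff, Set.mem_ofPred_eq]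
      omega
    · refine Set.disjoint_left.2 fun p => ?_
      simp only [V, T, Set.mem_union, Set.mem_singleton_iff, Set.mem_ofPred_eq]
      omega
    · intro p
      change (j < (p.1 : ℕ) ∧ k₁ + (p.1 : ℕ) ≠ c) ∨ ((p.1 : ℕ) < j ∧ k₁ + (p.1 : ℕ) ≠ c) ∨
        (k₁ + (p.1 : ℕ) = k₁ + j ∨ k₁ + (p.1 : ℕ) = c)
      omega
  have hsS : ∀ j, j < n → sigmaOf x (Set.Icc k₁ (k₁ + j) ∪ {c}) =
      sig (fun ω (p : β) => x (k₁ + p.1) ω p.2) (S j) := by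
    intro j hj
    refine sigmaOf_eq_s5 x _ ?_
    simp only [Set.mem_union, Set.mem_Icc, Set.mem_singleton_iff]
    omega
  have hsT : ∀ j, j < n → sigmaOf x ({k₁ + j} ∪ {c}) =
      sig (fun ω (p : β) => x (k₁ + p.1) ω p.2) (T j) := by
    intro j hj
    refine sigmaOf_eq_s5 x _ ?_
    simp only [Set.mem_union, Set.mem_singleton_iff]
    omega
  have hA : IsCM μ x k₁ N c ↔ ∀ j, ∀ u ∈ U j, ∀ v ∈ V j, P v u = 0 := by
    constructor
    · intro h j
      rw [← hcore]
      intro k hk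
      obtain ⟨k, a⟩ := k
      have hk1 : j < (k : ℕ) := hk.1
      have hk2 := k.2
      have h1 := h (k₁ + j) (k₁ + k) (by omega) (by omega) (by omega)
      unfold CondEq at h1
      rw [hsS j (by omega), hsT j (by omega)] at h1
      obtain ⟨g, hg, hg2⟩ := lin_of_cond hY hD hG (fun a : Fin d => (k, a)) (S j) (T j) (hTS j) h1 a
      exact ⟨g, hg, fun i hi => hg2 i ((hSU j i).2 hi)⟩
    · intro h j k hj hjk hk
      obtain ⟨j, rfl⟩ := Nat.exists_eq_add_of_le hj
      obtain ⟨k, rfl⟩ := Nat.exists_eq_add_of_le (hj.trans hjk.le)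
      unfold CondEq
      rw [hsS j (by omega), hsT j (by omega)]
      refine cond_of_lin hY hD hG (fun a : Fin d => (⟨k, by omega⟩, a)) (S j) (T j) (hTS j) ?_
      intro a
      by_cases hkc : k₁ + k = c
      · refine ⟨Pi.single (⟨k, by omega⟩, a) 1, ?_, by simp⟩
        intro i hi
        rw [Pi.single_apply, if_neg]
        rintro rfl
        apply hi
        exact Or.inr hkc
      · obtain ⟨g, hg, hg2⟩ := (hcore j).2 (h j) (⟨k, by omega⟩, a)
          ⟨by simp only; omega, hkc⟩
        exact ⟨g, hg, fun i hi => hg2 i ((hSU j i).1 hi)⟩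
  rw [hA]
  constructor
  · intro h i j hf hi hj a b
    rcases hf with hf | hf
    · exact h (i + 1) (j, b) ⟨by simp only; omega, hj⟩ (i, a) ⟨by simp only; omega, hi⟩
    · rw [hPs]
      exact h (j + 1) (i, a) ⟨by simp only; omega, hi⟩ (j, b) ⟨by simp only; omega, hj⟩
  · intro h j u hu v hv
    have h1 : j < (u.1 : ℕ) := hu.1
    have h2 : (v.1 : ℕ) < j := hv.1
    exact h v.1 u.1 (Or.inl (by omega)) hv.2 hu.2 v.2 u.2

/-- For `k₁ ∈ [1,N-1]` and `c ∈ {k₁,N}`: `[x_k]` is `[k₁,N]`-CM_c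
iff the Schur complement `Δ_{A11} = A22 - A12' A11⁻¹ A12` of `A = C⁻¹` has the
CM_c form (as a matrix of `(N-k₁+1) × (N-k₁+1)` blocks of size `d × d`;
the CM_F form for `c = k₁` and the CM_L form for `c = N`). -/
theorem stmt5 {N d : ℕ} (hN : 3 ≤ N) (hd : 1 ≤ d)
    (μ : Measure Ω) [IsProbabilityMeasure μ] (x : ℕ → Ω → Fin d → ℝ)
    (C : Matrix (Fin (N + 1) × Fin d) (Fin (N + 1) × Fin d) ℝ)
    (hx : ZMNG N d μ x C) (k₁ c : ℕ) (hk₁1 : 1 ≤ k₁) (hk₁2 : k₁ ≤ N - 1)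
    (hc : c = k₁ ∨ c = N) :
    let A := C⁻¹
    let r1 : Fin k₁ → Fin (N + 1) := Fin.castLE (by omega)
    let r2 : Fin (N - k₁ + 1) → Fin (N + 1) :=
      fun j => Fin.cast (by omega) (Fin.natAdd k₁ j)
    let A11 : Matrix (Fin k₁ × Fin d) (Fin k₁ × Fin d) ℝ :=
      fun p q => A (r1 p.1, p.2) (r1 q.1, q.2)
    let A22 : Matrix (Fin (N - k₁ + 1) × Fin d) (Fin (N - k₁ + 1) × Fin d) ℝ :=
      fun p q => A (r2 p.1, p.2) (r2 q.1, q.2)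
    let A12 : Matrix (Fin k₁ × Fin d) (Fin (N - k₁ + 1) × Fin d) ℝ :=
      fun p q => A (r1 p.1, p.2) (r2 q.1, q.2)
    let Δ := A22 - A12ᵀ * A11⁻¹ * A12
    (IsCM μ x k₁ N c ↔ (if c = k₁ then HasCMFForm Δ else HasCMLForm Δ)) := by
  intro A r1 r2 A11 A22 A12 Δ
  obtain ⟨hm, hG, hC⟩ := hx
  let f1 : Fin k₁ × Fin d → Fin (N + 1) × Fin d := fun p => (r1 p.1, p.2)
  let f2 : Fin (N - k₁ + 1) × Fin d → Fin (N + 1) × Fin d := fun p => (r2 p.1, p.2)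
  have hr1 : ∀ i, ((r1 i : Fin (N + 1)) : ℕ) = i := fun i => rfl
  have hr2 : ∀ i, ((r2 i : Fin (N + 1)) : ℕ) = k₁ + i := fun i => by simp [r2]
  have hf : Function.Bijective (Sum.elim f1 f2) := by
    constructor
    · rintro (⟨p, a⟩ | ⟨p, a⟩) (⟨q, b⟩ | ⟨q, b⟩) h <;>
        simp only [Sum.elim_inl, Sum.elim_inr, f1, f2, Prod.mk.injEq, Fin.ext_iff, hr1, hr2] at h
      · obtain ⟨h1, h2⟩ := h
        simp [Fin.ext_iff, h1, h2]
      · have := p.2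
        omega
      · have := q.2
        omega
      · obtain ⟨h1, h2⟩ := h
        have h3 : (p : ℕ) = q := by omega
        simp [Fin.ext_iff, h3, h2]
    · rintro ⟨i, a⟩
      by_cases hi : (i : ℕ) < k₁
      · exact ⟨Sum.inl (⟨i, hi⟩, a), by simp [f1, Fin.ext_iff, hr1]⟩
      · have := i.2
        refine ⟨Sum.inr (⟨i - k₁, by omega⟩, a), ?_⟩
        simp only [Sum.elim_inr, f2, Prod.mk.injEq, Fin.ext_iff, hr2, and_true]
        omega
  have hf2 : Function.Injective f2 := fun a b h => by
    have := @hf.1 (Sum.inr a) (Sum.inr b) (by simpa using h)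
    simpa using this
  have hPD : Δ * C.submatrix f2 f2 = 1 := schur_mul C hC f1 f2 hf
  have hYe : (fun ω (p : Fin (N - k₁ + 1) × Fin d) => x (k₁ + p.1) ω p.2) =
      fun ω p => stack N d x ω (f2 p) := by
    ext ω p
    simp only [stack, f2, hr2]
  have hY : Measurable fun ω (p : Fin (N - k₁ + 1) × Fin d) => x (k₁ + p.1) ω p.2 := by
    refine measurable_pi_iff.2 fun p => ?_
    have := p.1.2
    exact (measurable_pi_apply p.2).comp (hm (k₁ + p.1) (by omega))
  have hG2 : IsZeroMeanGaussian μ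
      (fun ω (p : Fin (N - k₁ + 1) × Fin d) => x (k₁ + p.1) ω p.2) (C.submatrix f2 f2) := by
    rw [hYe]
    exact gauss_sub hG f2
  rw [isCM_iff (n := N - k₁) (by omega) (by omega) μ x (C.submatrix f2 f2) Δ
    (hC.submatrix hf2) hPD hY hG2]
  split_ifs with hck
  · unfold HasCMFForm
    have e : ∀ i : Fin (N - k₁ + 1), k₁ + (i : ℕ) ≠ c ↔ (i : ℕ) ≠ 0 := fun i => by omega
    simp only [e]
  · unfold HasCMLForm
    have e : ∀ i : Fin (N - k₁ + 1), k₁ + (i : ℕ) ≠ c ↔ (i : ℕ) ≠ N - k₁ + 1 - 1 :=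
      fun i => by omega
    simp only [e]

end CMSeqPaper
end
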